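/- arXiv:1102.0677 — 2 statements merged into one kernel-verified Lean document; each statement's English description precedes it below -/
import Mathlib

section
/- Let 1 ≤ p1 ≤ p2 ≤ 2. Then there exists a constant c > 0, depending only on p1 and p2, such that for all N ∈ ℕ and all n ∈ ℕ with n ≤ N/4 one has c^{-1} ≤ d_n(id : ℓ_{p1}^N → ℓ_{p2}^N) ≤ c, i.e. d_n(id, ℓ_{p1}^N, ℓ_{p2}^N) ∼ 1. -/
open scoped ENNReal Classical

/-- The `ℓ_p` norm on `ℂ^N`, for `p ∈ [1, ∞]` (`p = ∞` gives the sup-norm). -/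
noncomputable def lpNorm (p : ℝ≥0∞) {N : ℕ} (x : Fin N → ℂ) : ℝ :=
  if p = ∞ then ⨆ i, ‖x i‖ else (∑ i, ‖x i‖ ^ p.toReal) ^ (1 / p.toReal)

/-- The `n`-th Kolmogorov number of the identity map `id : ℓ_{p1}^N → ℓ_{p2}^N`:
the infimum, over all linear subspaces `L` of `ℓ_{p2}^N` of dimension `< n`, of
`sup_{‖x‖_{p1} ≤ 1} inf_{y ∈ L} ‖x - y‖_{p2}`. -/
noncomputable def kolmogorovLp (p1 p2 : ℝ≥0∞) (N n : ℕ) : ℝ :=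
  sInf { r : ℝ | ∃ L : Submodule ℂ (Fin N → ℂ), Module.finrank ℂ L < n ∧
    r = sSup { t : ℝ | ∃ x : Fin N → ℂ, lpNorm p1 x ≤ 1 ∧
      t = sInf { s : ℝ | ∃ y ∈ L, s = lpNorm p2 (x - y) } } }

theorem sum_norm_sq_starProjection {ι E : Type*} [Fintype ι] [NormedAddCommGroup E]
    [InnerProductSpace ℂ E] [FiniteDimensional ℂ E] (b : OrthonormalBasis ι ℂ E)
    (K : Submodule ℂ E) :
    ∑ i, ‖K.starProjection (b i)‖ ^ 2 = Module.finrank ℂ K := by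
  have hproj : LinearMap.IsProj K (K.starProjection : E →ₗ[ℂ] E) :=
    ⟨fun x => by simp, fun x hx => by simpa using Submodule.starProjection_eq_self_iff.mpr hx⟩
  have htrace := hproj.trace
  rw [LinearMap.trace_eq_sum_inner _ b] at htrace
  have hterm : ∀ i, inner ℂ (b i) (K.starProjection (b i)) =
      ((‖K.starProjection (b i)‖ ^ 2 : ℝ) : ℂ) := fun i => by
    rw [← Submodule.starProjection_eq_self_iff.mpr (Submodule.starProjection_apply_mem K (b i)),
      ← Submodule.inner_starProjection_left_eq_right, inner_self_eq_norm_sq_to_K,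
      Submodule.starProjection_eq_self_iff.mpr (Submodule.starProjection_apply_mem K (b i))]
    simp
  simp only [ContinuousLinearMap.coe_coe, hterm] at htrace
  exact_mod_cast htrace

/-- Some vector of an orthonormal basis is far from a subspace of at most a quarter of the
dimension. -/
theorem exists_half_le_norm_sub {ι E : Type*} [Fintype ι] [Nonempty ι] [NormedAddCommGroup E]
    [InnerProductSpace ℂ E] [FiniteDimensional ℂ E] (b : OrthonormalBasis ι ℂ E)
    (K : Submodule ℂ E) (hK : (Module.finrank ℂ K : ℝ) ≤ Fintype.card ι / 4) :
    ∃ i, ∀ y ∈ K, 1 / 2 ≤ ‖b i - y‖ := by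
  obtain ⟨i, -, hi⟩ : ∃ i ∈ Finset.univ, ‖K.starProjection (b i)‖ ^ 2 ≤ 1 / 4 := by
    apply Finset.exists_le_of_sum_le Finset.univ_nonempty
    rw [sum_norm_sq_starProjection]
    simpa [div_eq_mul_inv] using hK
  refine ⟨i, fun y hy => ?_⟩
  have hbasis := Submodule.norm_sq_eq_add_norm_sq_starProjection (b i) K
  have hdiff := Submodule.norm_sq_eq_add_norm_sq_starProjection (b i - y) K
  have hy' : Kᗮ.starProjection y = 0 := by
    rw [Submodule.starProjection_orthogonal_val, Submodule.starProjection_eq_self_iff.mpr hy,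
      sub_self]
  rw [b.norm_eq_one] at hbasis
  rw [map_sub Kᗮ.starProjection, hy', sub_zero] at hdiff
  nlinarith [sq_nonneg ‖K.starProjection (b i - y)‖, norm_nonneg (b i - y)]

theorem lpNorm_eq_rpow {p : ℝ≥0∞} (hp : p ≠ ∞) {N : ℕ} (x : Fin N → ℂ) :
    lpNorm p x = (∑ i, ‖x i‖ ^ p.toReal) ^ (1 / p.toReal) := if_neg hp

theorem lpNorm_nonneg {p : ℝ≥0∞} (hp : p ≠ ∞) {N : ℕ} (x : Fin N → ℂ) : 0 ≤ lpNorm p x := by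
  rw [lpNorm_eq_rpow hp]
  positivity

theorem lpNorm_rpow {p : ℝ≥0∞} (hp0 : 0 < p.toReal) (hp : p ≠ ∞) {N : ℕ} (x : Fin N → ℂ) :
    lpNorm p x ^ p.toReal = ∑ i, ‖x i‖ ^ p.toReal := by
  rw [lpNorm_eq_rpow hp, one_div, Real.rpow_inv_rpow (by positivity) hp0.ne']

theorem lpNorm_antitone {p q : ℝ≥0∞} (hp : 1 ≤ p) (hpq : p ≤ q) (hq : q ≠ ∞) {N : ℕ}
    (x : Fin N → ℂ) : lpNorm q x ≤ lpNorm p x := by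
  have hp' : p ≠ ∞ := ne_top_of_le_ne_top hq hpq
  have hp0 : 0 < p.toReal := ENNReal.toReal_pos (zero_lt_one.trans_le hp).ne' hp'
  have hle : p.toReal ≤ q.toReal := ENNReal.toReal_mono hq hpq
  have hq0 : 0 < q.toReal := hp0.trans_le hle
  have hcoord : ∀ i, ‖x i‖ ≤ lpNorm p x := fun i => by
    rw [← Real.rpow_le_rpow_iff (norm_nonneg _) (lpNorm_nonneg hp' x) hp0, lpNorm_rpow hp0 hp']
    exact Finset.single_le_sum (f := fun j => ‖x j‖ ^ p.toReal)
      (fun j _ => by positivity) (Finset.mem_univ i)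
  have hsplit : ∀ {a : ℝ}, 0 ≤ a → a ^ q.toReal = a ^ p.toReal * a ^ (q.toReal - p.toReal) :=
    fun {a} ha => by
      rw [← Real.rpow_add_of_nonneg ha hp0.le (sub_nonneg.mpr hle), add_sub_cancel]
  rw [← Real.rpow_le_rpow_iff (lpNorm_nonneg hq x) (lpNorm_nonneg hp' x) hq0,
    lpNorm_rpow hq0 hq, hsplit (lpNorm_nonneg hp' x), lpNorm_rpow hp0 hp', Finset.sum_mul]
  refine Finset.sum_le_sum fun i _ => ?_
  rw [hsplit (norm_nonneg _)]
  have := sub_nonneg.mpr hle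
  gcongr
  exact hcoord i

theorem lpNorm_two {N : ℕ} (x : Fin N → ℂ) : lpNorm 2 x = ‖WithLp.toLp 2 x‖ := by
  rw [lpNorm_eq_rpow (by simp), EuclideanSpace.norm_eq, Real.sqrt_eq_rpow]
  simp

theorem lpNorm_single {p : ℝ≥0∞} (hp : 1 ≤ p) (hp' : p ≠ ∞) {N : ℕ} (i : Fin N) :
    lpNorm p (Pi.single i (1 : ℂ)) = 1 := by
  have hp0 : 0 < p.toReal := ENNReal.toReal_pos (zero_lt_one.trans_le hp).ne' hp'
  rw [lpNorm_eq_rpow hp', Finset.sum_eq_single i]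
  · simp
  · intro j _ hj
    simp [hj, Real.zero_rpow hp0.ne']
  · simp

/-- The distances from the unit ball of `ℓ_p^N` to `L` in `ℓ_q^N` are bounded by one. -/
theorem sInf_lpNorm_sub_le_one {p q : ℝ≥0∞} (hp : 1 ≤ p) (hpq : p ≤ q) (hq : q ≠ ∞) {N : ℕ}
    (L : Submodule ℂ (Fin N → ℂ)) {x : Fin N → ℂ} (hx : lpNorm p x ≤ 1) :
    sInf { s : ℝ | ∃ y ∈ L, s = lpNorm q (x - y) } ≤ 1 := by
  refine le_trans (csInf_le ⟨0, ?_⟩ ⟨0, L.zero_mem, rfl⟩) ?_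
  · rintro _ ⟨y, -, rfl⟩
    exact lpNorm_nonneg hq _
  · rw [sub_zero]
    exact (lpNorm_antitone hp hpq hq x).trans hx

/-- A subspace of at most a quarter of the dimension has deviation at least one half. -/
theorem half_le_sSup_sInf_lpNorm_sub {p q : ℝ≥0∞} (hp : 1 ≤ p) (hpq : p ≤ q) (hq : q ≤ 2) {N : ℕ}
    (hN : 0 < N) (L : Submodule ℂ (Fin N → ℂ)) (hL : (Module.finrank ℂ L : ℝ) ≤ N / 4) :
    1 / 2 ≤ sSup { t : ℝ | ∃ x : Fin N → ℂ, lpNorm p x ≤ 1 ∧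
      t = sInf { s : ℝ | ∃ y ∈ L, s = lpNorm q (x - y) } } := by
  have hq' : q ≠ ∞ := ne_top_of_le_ne_top (by simp) hq
  have : Nonempty (Fin N) := ⟨⟨0, hN⟩⟩
  let e := (WithLp.linearEquiv 2 ℂ (Fin N → ℂ)).symm
  obtain ⟨i, hi⟩ := exists_half_le_norm_sub (EuclideanSpace.basisFun (Fin N) ℂ)
    (L.map (e : (Fin N → ℂ) →ₗ[ℂ] EuclideanSpace ℂ (Fin N)))
    (by simpa [LinearEquiv.finrank_map_eq] using hL)
  refine le_csSup_of_le ⟨1, ?_⟩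
    ⟨Pi.single i 1, (lpNorm_single hp (ne_top_of_le_ne_top hq' hpq) i).le, rfl⟩ ?_
  · rintro _ ⟨x, hx, rfl⟩
    exact sInf_lpNorm_sub_le_one hp hpq hq' L hx
  · refine le_csInf ⟨_, 0, L.zero_mem, rfl⟩ ?_
    rintro _ ⟨y, hy, rfl⟩
    refine le_trans ?_ (lpNorm_antitone (hp.trans hpq) hq (by simp) _)
    rw [lpNorm_two]
    simpa [e] using hi (e y) (Submodule.mem_map_of_mem hy)

/-- Let `1 ≤ p1 ≤ p2 ≤ 2`. There is a constant `c > 0`, depending only on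
`p1, p2`, such that for all `N` and all `n` with `n ≤ N/4`,
`c⁻¹ ≤ d_n(id : ℓ_{p1}^N → ℓ_{p2}^N) ≤ c`. -/
theorem kolmogorov_id_lp_le_two (p1 p2 : ℝ≥0∞) (hp1 : 1 ≤ p1) (hp12 : p1 ≤ p2)
    (hp2 : p2 ≤ 2) :
    ∃ c : ℝ, 0 < c ∧ ∀ N n : ℕ, 1 ≤ n → (n : ℝ) ≤ (N : ℝ) / 4 →
      c⁻¹ ≤ kolmogorovLp p1 p2 N n ∧ kolmogorovLp p1 p2 N n ≤ c := by
  refine ⟨2, two_pos, fun N n hn hnN => ?_⟩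
  have hn' : (1 : ℝ) ≤ n := by exact_mod_cast hn
  have hN : 0 < N := by
    have : (0 : ℝ) < N := by linarith
    exact_mod_cast this
  have hbot : Module.finrank ℂ (⊥ : Submodule ℂ (Fin N → ℂ)) < n := by
    rwa [finrank_bot]
  have hlow : ∀ L : Submodule ℂ (Fin N → ℂ), Module.finrank ℂ L < n →
      1 / 2 ≤ sSup { t : ℝ | ∃ x : Fin N → ℂ, lpNorm p1 x ≤ 1 ∧
        t = sInf { s : ℝ | ∃ y ∈ L, s = lpNorm p2 (x - y) } } := fun L hL =>
    half_le_sSup_sInf_lpNorm_sub hp1 hp12 hp2 hN L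
      (le_trans (by exact_mod_cast hL.le) hnN)
  constructor
  · refine le_csInf ⟨_, ⊥, hbot, rfl⟩ ?_
    rintro _ ⟨L, hL, rfl⟩
    simpa using hlow L hL
  · refine le_trans (csInf_le ⟨1 / 2, ?_⟩ ⟨⊥, hbot, rfl⟩) ?_
    · rintro _ ⟨L, hL, rfl⟩
      exact hlow L hL
    · refine Real.sSup_le ?_ zero_le_two
      rintro _ ⟨x, hx, rfl⟩
      exact (sInf_lpNorm_sub_le_one hp1 hp12 (ne_top_of_le_ne_top (by simp) hp2) ⊥ hx).trans
        one_le_two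
end

section
/- Let 2 ≤ p1 < p2 < ∞ and set θ = (1/p1 − 1/p2)/(1/2 − 1/p2). Then there exists a constant c > 0, depending only on p1 and p2, such that for all N ∈ ℕ and all n ∈ ℕ with n ≤ N one has c^{-1} ξ^θ ≤ d_n(id : ℓ_{p1}^N → ℓ_{p2}^N) ≤ c ξ^θ, where ξ = min{1, N^{1/p2} n^{-1/2}}. -/
open scoped ENNReal Classical

section Rademacher

/-- One step of symmetrization and contraction, for a symmetric finite family `b` of bounded
functions. -/
theorem sum_ciSup_mean_abs_sub_le {R ι : Type*} [Fintype R] [Nonempty R] [Nonempty ι] (e : R ≃ R)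
    (b : R → ι → ℝ) (hneg : ∀ r z, b (e r) z = -b r z) (C : ℝ) (hb : ∀ r z, |b r z| ≤ C)
    (a : ι → ℝ) (A : ℝ) (ha : ∀ z, |a z| ≤ A) :
    ∑ r, ⨆ z, (a z + ((∑ r', |b r' z|) / Fintype.card R - |b r z|)) ≤
      ∑ r, ⨆ z, (a z + 2 * b r z) := by
  set G : R → ℝ := fun r => ⨆ z, (a z + 2 * b r z) with hG
  set P : R → ℝ := fun r => ⨆ z, (a z + 2 * |b r z|) with hP
  set M : R → ℝ := fun r => ⨆ z, (a z - 2 * |b r z|) with hM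
  have hGle : ∀ r z, a z + 2 * b r z ≤ G r := fun r z =>
    le_ciSup (f := fun z => a z + 2 * b r z) ⟨A + 2 * C, by
      rintro _ ⟨w, rfl⟩
      linarith [(abs_le.1 (ha w)).2, (abs_le.1 (hb r w)).2]⟩ z
  have hPle : ∀ r z, a z + 2 * |b r z| ≤ P r := fun r z =>
    le_ciSup (f := fun z => a z + 2 * |b r z|) ⟨A + 2 * C, by
      rintro _ ⟨w, rfl⟩
      linarith [(abs_le.1 (ha w)).2, hb r w]⟩ z
  have hMle : ∀ r z, a z - 2 * |b r z| ≤ M r := fun r z =>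
    le_ciSup (f := fun z => a z - 2 * |b r z|) ⟨A, by
      rintro _ ⟨w, rfl⟩
      linarith [(abs_le.1 (ha w)).2, abs_nonneg (b r w)]⟩ z
  have hPM : ∀ r, P r + M r ≤ G r + G (e r) := by
    intro r
    have key : ∀ z w, a z + 2 * |b r z| + (a w - 2 * |b r w|) ≤ G r + G (e r) := by
      intro z w
      have h1 := hGle r z
      have h2 := hGle r w
      have h3 := hGle (e r) z
      have h4 := hGle (e r) w
      rw [hneg] at h3 h4
      have := le_abs_self (b r w)
      have := neg_le_abs (b r w)
      rcases abs_cases (b r z) with h | h <;> linarith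
    have h1 : P r ≤ G r + G (e r) - M r := ciSup_le fun z => by
      have : M r ≤ G r + G (e r) - (a z + 2 * |b r z|) := ciSup_le fun w => by
        linarith [key z w]
      linarith
    linarith
  have hcard : (0 : ℝ) < Fintype.card R := by exact_mod_cast Fintype.card_pos
  have hstep : ∀ r, (⨆ z, (a z + ((∑ r', |b r' z|) / Fintype.card R - |b r z|))) ≤
      (∑ r', P r') / Fintype.card R / 2 + M r / 2 := by
    intro r
    refine ciSup_le fun z => ?_
    have h1 : (∑ r', (a z + 2 * |b r' z|)) ≤ ∑ r', P r' :=
      Finset.sum_le_sum fun r' _ => hPle r' z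
    have h2 : (∑ r', (a z + 2 * |b r' z|)) / Fintype.card R =
        a z + 2 * ((∑ r', |b r' z|) / Fintype.card R) := by
      rw [Finset.sum_add_distrib, ← Finset.mul_sum]
      simp
      field_simp
    have h3 := div_le_div_of_nonneg_right h1 hcard.le
    linarith [hMle r z]
  calc _ ≤ ∑ r, ((∑ r', P r') / Fintype.card R / 2 + M r / 2) :=
        Finset.sum_le_sum fun r _ => hstep r
    _ = (∑ r, (P r + M r)) / 2 := by
        rw [Finset.sum_add_distrib, Finset.sum_add_distrib, ← Finset.sum_div Finset.univ M]
        simp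
        field_simp
    _ ≤ (∑ r, (G r + G (e r))) / 2 := by
        exact div_le_div_of_nonneg_right (Finset.sum_le_sum fun r _ => hPM r) zero_le_two
    _ = ∑ r, G r := by
        rw [Finset.sum_add_distrib, e.sum_comp G]
        ring

theorem sum_fin_succ_fun {R : Type*} [Fintype R] (M : ℕ) (f : (Fin (M + 1) → R) → ℝ) :
    ∑ r, f r = ∑ r0 : R, ∑ r : Fin M → R, f (Fin.cons r0 r) := by
  rw [← (Fin.consEquiv fun _ : Fin (M + 1) => R).sum_comp f, Fintype.sum_prod_type]
  rfl

theorem sum_ciSup_sum_mean_abs_sub_le {R ι : Type*} [Fintype R] [Nonempty R] [Nonempty ι]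
    (e : R ≃ R) (b : R → ι → ℝ) (hneg : ∀ r z, b (e r) z = -b r z) (C : ℝ)
    (hb : ∀ r z, |b r z| ≤ C) (M : ℕ) (a : ι → ℝ) (A : ℝ) (ha : ∀ z, |a z| ≤ A) :
    ∑ r : Fin M → R, ⨆ z, (a z + ∑ i, ((∑ r', |b r' z|) / Fintype.card R - |b (r i) z|)) ≤
      ∑ r : Fin M → R, ⨆ z, (a z + 2 * ∑ i, b (r i) z) := by
  have hcard : (0 : ℝ) < Fintype.card R := by exact_mod_cast Fintype.card_pos
  have hmean : ∀ z, |(∑ r', |b r' z|) / Fintype.card R| ≤ C := by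
    intro z
    rw [abs_of_nonneg (by positivity), div_le_iff₀ hcard]
    calc _ ≤ ∑ _r : R, C := Finset.sum_le_sum fun r _ => hb r z
      _ = _ := by simp [mul_comm]
  induction M generalizing a A with
  | zero => simp
  | succ M ih =>
    rw [sum_fin_succ_fun, sum_fin_succ_fun]
    simp only [Fin.sum_univ_succ, Fin.cons_zero, Fin.cons_succ]
    calc _ = ∑ r0 : R, ∑ r : Fin M → R, ⨆ z,
          ((a z + ((∑ r', |b r' z|) / Fintype.card R - |b r0 z|)) +
            ∑ i, ((∑ r', |b r' z|) / Fintype.card R - |b (r i) z|)) := by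
          simp only [add_assoc]
      _ ≤ ∑ r0 : R, ∑ r : Fin M → R, ⨆ z,
          ((a z + ((∑ r', |b r' z|) / Fintype.card R - |b r0 z|)) + 2 * ∑ i, b (r i) z) := by
          refine Finset.sum_le_sum fun r0 _ => ih _ (A + (C + C)) fun z => ?_
          have h1 := abs_le.1 (ha z)
          have h2 := abs_le.1 (hmean z)
          have h3 := hb r0 z
          have h4 := abs_nonneg (b r0 z)
          rw [abs_le]
          constructor <;> linarith
      _ = ∑ r : Fin M → R, ∑ r0 : R, ⨆ z,
          ((a z + 2 * ∑ i, b (r i) z) + ((∑ r', |b r' z|) / Fintype.card R - |b r0 z|)) := by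
          rw [Finset.sum_comm]
          simp only [add_right_comm]
      _ ≤ ∑ r : Fin M → R, ∑ r0 : R, ⨆ z, ((a z + 2 * ∑ i, b (r i) z) + 2 * b r0 z) := by
          refine Finset.sum_le_sum fun r _ => ?_
          refine sum_ciSup_mean_abs_sub_le e b hneg C hb _ (A + 2 * (M * C)) fun z => ?_
          have h1 : |∑ i, b (r i) z| ≤ M * C := by
            calc _ ≤ ∑ i, |b (r i) z| := Finset.abs_sum_le_sum_abs _ _
              _ ≤ ∑ _i : Fin M, C := Finset.sum_le_sum fun i _ => hb _ z
              _ = _ := by simp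
          have h2 := abs_le.1 (ha z)
          have h3 := abs_le.1 h1
          rw [abs_le]
          constructor <;> linarith
      _ = _ := by
          rw [Finset.sum_comm]
          refine Finset.sum_congr rfl fun r0 _ => Finset.sum_congr rfl fun r _ => ?_
          congr 1
          ext z
          ring

/-- The Rademacher sum `∑ j, v j * x j` attached to a vector of signs `v`. -/
def signSum {N : ℕ} (v : Fin N → ℤˣ) (x : Fin N → ℝ) : ℝ := ∑ j, ((v j : ℤ) : ℝ) * x j

theorem sum_signSum_sq_and_pow_four (N : ℕ) (x : Fin N → ℝ) :
    ∑ v : Fin N → ℤˣ, signSum v x ^ 2 = 2 ^ N * ∑ j, x j ^ 2 ∧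
      ∑ v : Fin N → ℤˣ, signSum v x ^ 4 ≤ 3 * 2 ^ N * (∑ j, x j ^ 2) ^ 2 := by
  induction N with
  | zero => simp [signSum]
  | succ N ih =>
    obtain ⟨h2, h4⟩ := ih (fun j => x j.succ)
    have hs : ∀ (u : ℤˣ) (v : Fin N → ℤˣ), signSum (Fin.cons u v : Fin (N + 1) → ℤˣ) x =
        ((u : ℤ) : ℝ) * x 0 + signSum v (fun j => x j.succ) := by
      intro u v
      simp [signSum, Fin.sum_univ_succ]
    have hu : ∀ f : ℤˣ → ℝ, ∑ u, f u = f 1 + f (-1) := by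
      intro f
      rw [UnitsInt.univ, Finset.sum_pair (by decide)]
    have hone : ∑ _v : Fin N → ℤˣ, (1 : ℝ) = 2 ^ N := by simp
    rw [sum_fin_succ_fun, sum_fin_succ_fun, hu, hu, Fin.sum_univ_succ]
    simp only [hs]
    rw [← Finset.sum_add_distrib, ← Finset.sum_add_distrib]
    set Y : (Fin N → ℤˣ) → ℝ := fun v => signSum v (fun j => x j.succ)
    set T := ∑ j : Fin N, x j.succ ^ 2
    have e2 : ∑ v : Fin N → ℤˣ, ((((1 : ℤˣ) : ℤ) * x 0 + Y v) ^ 2 +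
        ((((-1 : ℤˣ) : ℤ) : ℝ) * x 0 + Y v) ^ 2) = 2 * x 0 ^ 2 * 2 ^ N + 2 * (2 ^ N * T) := by
      rw [← h2, ← hone, Finset.mul_sum, Finset.mul_sum, ← Finset.sum_add_distrib]
      refine Finset.sum_congr rfl fun v _ => ?_
      push_cast
      ring
    have e4 : ∑ v : Fin N → ℤˣ, ((((1 : ℤˣ) : ℤ) * x 0 + Y v) ^ 4 +
        ((((-1 : ℤˣ) : ℤ) : ℝ) * x 0 + Y v) ^ 4) =
        2 * x 0 ^ 4 * 2 ^ N + 12 * x 0 ^ 2 * (2 ^ N * T) + 2 * ∑ v, Y v ^ 4 := by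
      rw [← h2, ← hone, Finset.mul_sum, Finset.mul_sum, Finset.mul_sum,
        ← Finset.sum_add_distrib, ← Finset.sum_add_distrib]
      refine Finset.sum_congr rfl fun v _ => ?_
      push_cast
      ring
    constructor
    · rw [e2]; ring
    · rw [e4]
      have : 0 ≤ x 0 ^ 4 * 2 ^ N := by positivity
      calc _ ≤ 2 * x 0 ^ 4 * 2 ^ N + 12 * x 0 ^ 2 * (2 ^ N * T) + 2 * (3 * 2 ^ N * T ^ 2) := by
            gcongr
        _ ≤ _ := by ring_nf; linarith

/-- The Khintchine lower bound for the first absolute moment of a Rademacher sum. -/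
theorem sqrt_le_mean_abs_signSum {N : ℕ} (x : Fin N → ℝ) :
    √(∑ j, x j ^ 2) / 2 ≤
      (∑ v : Fin N → ℤˣ, |signSum v x|) / Fintype.card (Fin N → ℤˣ) := by
  obtain ⟨h2, h4⟩ := sum_signSum_sq_and_pow_four N x
  have hT : 0 ≤ ∑ j, x j ^ 2 := Finset.sum_nonneg fun j _ => sq_nonneg _
  have hcard : (Fintype.card (Fin N → ℤˣ) : ℝ) = 2 ^ N := by simp
  rw [hcard]
  rcases hT.eq_or_lt with h0 | hpos
  · rw [← h0]; simp only [Real.sqrt_zero, zero_div]; positivity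
  set σ := √(∑ j, x j ^ 2) with hσ
  have hσpos : 0 < σ := Real.sqrt_pos.2 hpos
  have hσsq : ∑ j, x j ^ 2 = σ ^ 2 := (Real.sq_sqrt hT).symm
  rw [hσsq] at h2 h4
  have hpt : ∀ t : ℝ, 3 / 4 * t ^ 2 / σ - t ^ 4 / (12 * σ ^ 3) ≤ |t| := by
    intro t
    have h : 9 * t ^ 2 * σ ^ 2 - t ^ 4 ≤ 12 * |t| * σ ^ 3 := by
      rw [← sq_abs t, show t ^ 4 = |t| ^ 4 from ((by decide : Even 4).pow_abs t).symm]
      set u := |t|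
      have hu : 0 ≤ u := abs_nonneg t
      have : 0 ≤ u * (12 * σ ^ 3 - 9 * u * σ ^ 2 + u ^ 3) := by
        refine mul_nonneg hu ?_
        nlinarith [mul_nonneg (by positivity : 0 ≤ u + 7 / 2 * σ) (sq_nonneg (u - 7 / 4 * σ)),
          mul_nonneg hu (sq_nonneg σ), pow_pos hσpos 3]
      nlinarith
    rw [show 3 / 4 * t ^ 2 / σ - t ^ 4 / (12 * σ ^ 3) =
      (9 * t ^ 2 * σ ^ 2 - t ^ 4) / (12 * σ ^ 3) by field_simp; ring, div_le_iff₀ (by positivity)]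
    linarith
  rw [le_div_iff₀ (by positivity)]
  calc σ / 2 * 2 ^ N = 3 / 4 * (2 ^ N * σ ^ 2) / σ - (3 * 2 ^ N * (σ ^ 2) ^ 2) / (12 * σ ^ 3) := by
        field_simp; norm_num
    _ ≤ 3 / 4 * (∑ v : Fin N → ℤˣ, signSum v x ^ 2) / σ -
          (∑ v : Fin N → ℤˣ, signSum v x ^ 4) / (12 * σ ^ 3) := by
        rw [h2]; gcongr
    _ = ∑ v : Fin N → ℤˣ, (3 / 4 * signSum v x ^ 2 / σ - signSum v x ^ 4 / (12 * σ ^ 3)) := by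
        rw [Finset.sum_sub_distrib, ← Finset.sum_div, ← Finset.sum_div, ← Finset.mul_sum]
    _ ≤ _ := Finset.sum_le_sum fun v _ => hpt _

theorem abs_rpow_le_factorial_mul_exp {q : ℝ} (hq : 0 ≤ q) (s : ℝ) :
    |s| ^ q ≤ (⌈q⌉₊.factorial : ℝ) * (Real.exp s + Real.exp (-s)) := by
  have hf : (1 : ℝ) ≤ ⌈q⌉₊.factorial := by
    exact_mod_cast Nat.one_le_iff_ne_zero.2 (Nat.factorial_ne_zero _)
  have hexp : Real.exp |s| ≤ Real.exp s + Real.exp (-s) := by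
    rcases abs_cases s with h | h <;> rw [h.1]
    · linarith [Real.exp_pos (-s)]
    · linarith [Real.exp_pos s]
  have h1 : |s| ^ q ≤ (⌈q⌉₊.factorial : ℝ) * Real.exp |s| := by
    rcases le_total |s| 1 with h | h
    · calc |s| ^ q ≤ 1 := Real.rpow_le_one (abs_nonneg s) h hq
        _ ≤ 1 * Real.exp |s| := by rw [one_mul]; exact Real.one_le_exp (abs_nonneg s)
        _ ≤ _ := by gcongr
    · calc |s| ^ q ≤ |s| ^ (⌈q⌉₊ : ℝ) := Real.rpow_le_rpow_of_exponent_le h (Nat.le_ceil q)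
        _ = |s| ^ ⌈q⌉₊ := Real.rpow_natCast _ _
        _ ≤ _ := by
          have := Real.pow_div_factorial_le_exp |s| (abs_nonneg s) ⌈q⌉₊
          rw [div_le_iff₀ (by positivity)] at this
          linarith
  exact h1.trans (by gcongr)

theorem sum_exp_signs_le {N : ℕ} (M : ℕ) (j : Fin N) (t : ℝ) :
    ∑ r : Fin M → Fin N → ℤˣ, Real.exp (t * ∑ i, ((r i j : ℤ) : ℝ)) ≤
      Fintype.card (Fin M → Fin N → ℤˣ) * Real.exp (M * t ^ 2 / 2) := by
  have h1 : ∑ v : Fin N → ℤˣ, Real.exp (t * ((v j : ℤ) : ℝ)) = 2 ^ N * Real.cosh t := by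
    have hn : ∑ v : Fin N → ℤˣ, Real.exp (t * ((v j : ℤ) : ℝ)) =
        ∑ v : Fin N → ℤˣ, Real.exp (-(t * ((v j : ℤ) : ℝ))) := by
      rw [← Equiv.sum_comp (Equiv.neg (Fin N → ℤˣ))]
      simp
    have h2 : ∀ v : Fin N → ℤˣ, Real.exp (t * ((v j : ℤ) : ℝ)) +
        Real.exp (-(t * ((v j : ℤ) : ℝ))) = 2 * Real.cosh t := by
      intro v
      rw [Real.cosh_eq]
      rcases Int.units_eq_one_or (v j) with h | h <;> rw [h] <;> simp <;> ring
    have h3 : ∑ v : Fin N → ℤˣ, (Real.exp (t * ((v j : ℤ) : ℝ)) +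
        Real.exp (-(t * ((v j : ℤ) : ℝ)))) = 2 ^ N * (2 * Real.cosh t) := by
      simp [h2]
    rw [Finset.sum_add_distrib, ← hn] at h3
    linarith
  have h2 : ∑ r : Fin M → Fin N → ℤˣ, Real.exp (t * ∑ i, ((r i j : ℤ) : ℝ)) =
      (2 ^ N * Real.cosh t) ^ M := by
    rw [← h1, Fintype.sum_pow]
    refine Finset.sum_congr rfl fun r _ => ?_
    rw [Finset.mul_sum, Real.exp_sum]
  rw [h2, mul_pow]
  have h3 : ((2 : ℝ) ^ N) ^ M = Fintype.card (Fin M → Fin N → ℤˣ) := by simp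
  rw [h3]
  gcongr
  calc Real.cosh t ^ M ≤ Real.exp (t ^ 2 / 2) ^ M := by
        gcongr
        exact Real.cosh_le_exp_half_sq t
    _ = _ := by rw [← Real.exp_nat_mul]; congr 1; ring

/-- The Khintchine upper bound for the `q`-th absolute moment of a sum of `M` signs. -/
theorem sum_abs_sum_signs_rpow_le {q : ℝ} (hq : 0 ≤ q) {N : ℕ} {M : ℕ} (hM : 1 ≤ M) (j : Fin N) :
    ∑ r : Fin M → Fin N → ℤˣ, |∑ i, ((r i j : ℤ) : ℝ)| ^ q ≤
      Fintype.card (Fin M → Fin N → ℤˣ) *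
        ((⌈q⌉₊.factorial : ℝ) * (2 * Real.exp (1 / 2)) * (√M) ^ q) := by
  have hMpos : (0 : ℝ) < M := by exact_mod_cast hM
  have hs : 0 < √(M : ℝ) := Real.sqrt_pos.2 hMpos
  set F : ℝ := (⌈q⌉₊.factorial : ℝ)
  set K : ℝ := (Fintype.card (Fin M → Fin N → ℤˣ) : ℝ)
  have hpt : ∀ r : Fin M → Fin N → ℤˣ, |∑ i, ((r i j : ℤ) : ℝ)| ^ q ≤
      (√M) ^ q * (F * (Real.exp ((√M)⁻¹ * ∑ i, ((r i j : ℤ) : ℝ)) +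
        Real.exp (-(√M)⁻¹ * ∑ i, ((r i j : ℤ) : ℝ)))) := by
    intro r
    have h := abs_rpow_le_factorial_mul_exp hq ((√M)⁻¹ * ∑ i, ((r i j : ℤ) : ℝ))
    rw [abs_mul, abs_of_pos (inv_pos.2 hs), Real.mul_rpow (inv_pos.2 hs).le (abs_nonneg _),
      Real.inv_rpow hs.le, inv_mul_le_iff₀ (by positivity)] at h
    rwa [neg_mul]
  have he : ∀ t : ℝ, t ^ 2 = (M : ℝ)⁻¹ → ∑ r : Fin M → Fin N → ℤˣ,
      Real.exp (t * ∑ i, ((r i j : ℤ) : ℝ)) ≤ K * Real.exp (1 / 2) := by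
    intro t ht
    have := sum_exp_signs_le M j t
    rwa [ht, mul_inv_cancel₀ hMpos.ne'] at this
  have hsq : ((√(M : ℝ))⁻¹) ^ 2 = (M : ℝ)⁻¹ := by rw [inv_pow, Real.sq_sqrt hMpos.le]
  calc _ ≤ ∑ r : Fin M → Fin N → ℤˣ, (√M) ^ q * (F *
        (Real.exp ((√M)⁻¹ * ∑ i, ((r i j : ℤ) : ℝ)) +
        Real.exp (-(√M)⁻¹ * ∑ i, ((r i j : ℤ) : ℝ)))) := Finset.sum_le_sum fun r _ => hpt r
    _ = (√M) ^ q * (F * (∑ r : Fin M → Fin N → ℤˣ, Real.exp ((√M)⁻¹ * ∑ i, ((r i j : ℤ) : ℝ)) +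
        ∑ r : Fin M → Fin N → ℤˣ, Real.exp (-(√M)⁻¹ * ∑ i, ((r i j : ℤ) : ℝ)))) := by
        rw [← Finset.mul_sum, ← Finset.mul_sum, Finset.sum_add_distrib]
    _ ≤ (√M) ^ q * (F * (K * Real.exp (1 / 2) + K * Real.exp (1 / 2))) := by
        gcongr
        · exact he _ hsq
        · exact he _ (by rw [neg_sq, hsq])
    _ = _ := by ring

end Rademacher

section Upper

/-- A random matrix of signs has a kernel on which the Euclidean norm is controlled by the norm
dual to `ℓ_q`. -/
theorem exists_signs_sqrt_le {q : ℝ} (hq : 1 ≤ q) (N : ℕ) {M : ℕ} (hM : 1 ≤ M) :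
    ∃ r : Fin M → Fin N → ℤˣ, ∀ z : Fin N → ℝ,
      (∀ y : Fin N → ℝ, ∑ j, z j * y j ≤ (∑ j, |y j| ^ q) ^ (1 / q)) →
      (∀ i, signSum (r i) z = 0) →
      √(∑ j, z j ^ 2) ≤ 4 * ((⌈q⌉₊.factorial : ℝ) * (2 * Real.exp (1 / 2))) ^ (1 / q) *
        (N : ℝ) ^ (1 / q) / √M := by
  have hq0 : 0 < q := by linarith
  have hMpos : (0 : ℝ) < M := by exact_mod_cast hM
  set C : ℝ := (⌈q⌉₊.factorial : ℝ) * (2 * Real.exp (1 / 2)) with hC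
  have hC0 : 0 ≤ C := by positivity
  set K := {z : Fin N → ℝ // ∀ y : Fin N → ℝ, ∑ j, z j * y j ≤ (∑ j, |y j| ^ q) ^ (1 / q)} with hK
  have : Nonempty K := ⟨⟨0, fun y => by simp; positivity⟩⟩
  set b : (Fin N → ℤˣ) → K → ℝ := fun v z => signSum v z.1 with hb
  have hneg : ∀ v z, b (Equiv.neg (Fin N → ℤˣ) v) z = -b v z := by
    intro v z
    simp [hb, signSum]
  have hle : ∀ v z, b v z ≤ (N : ℝ) ^ (1 / q) := by
    intro v z
    have h := z.2 fun j => ((v j : ℤ) : ℝ)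
    have h1 : ∀ j, |((v j : ℤ) : ℝ)| ^ q = 1 := by
      intro j
      rcases Int.units_eq_one_or (v j) with h | h <;> rw [h] <;> simp
    simp only [h1] at h
    simpa [hb, signSum, mul_comm] using h
  have hbdd : ∀ v z, |b v z| ≤ (N : ℝ) ^ (1 / q) := by
    intro v z
    rw [abs_le]
    have := hle (Equiv.neg (Fin N → ℤˣ) v) z
    rw [hneg] at this
    exact ⟨by linarith, hle v z⟩
  have main := sum_ciSup_sum_mean_abs_sub_le (Equiv.neg (Fin N → ℤˣ)) b hneg _ hbdd M
    (fun _ => 0) 0 (by simp)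
  set T : ℝ := (Fintype.card (Fin M → Fin N → ℤˣ) : ℝ) with hT
  have hTpos : 0 < T := by simp only [hT]; exact_mod_cast Fintype.card_pos
  set B : ℝ := C ^ (1 / q) * (N : ℝ) ^ (1 / q) * √M with hB
  have hright : ∑ r : Fin M → Fin N → ℤˣ, ⨆ z, (0 + 2 * ∑ i, b (r i) z) ≤ T * (2 * B) := by
    have h1 : ∀ r : Fin M → Fin N → ℤˣ, (⨆ z, (0 + 2 * ∑ i, b (r i) z)) ≤
        2 * (∑ j, |∑ i, ((r i j : ℤ) : ℝ)| ^ q) ^ (1 / q) := by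
      intro r
      refine ciSup_le fun z => ?_
      have h := z.2 fun j => ∑ i, ((r i j : ℤ) : ℝ)
      have h2 : ∑ i, b (r i) z = ∑ j, z.1 j * ∑ i, ((r i j : ℤ) : ℝ) := by
        simp only [hb, signSum, Finset.mul_sum]
        rw [Finset.sum_comm]
        simp only [mul_comm]
      rw [h2]
      linarith
    have h2 : ∑ r : Fin M → Fin N → ℤˣ, T⁻¹ * (∑ j, |∑ i, ((r i j : ℤ) : ℝ)| ^ q) ^ (1 / q) ≤
        B := by
      refine (Real.arith_mean_le_rpow_mean Finset.univ (fun _ => T⁻¹) _ (fun _ _ => by positivity)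
        (by simp [hT]) (fun _ _ => by positivity) hq).trans ?_
      have h3 : ∀ r : Fin M → Fin N → ℤˣ,
          ((∑ j, |∑ i, ((r i j : ℤ) : ℝ)| ^ q) ^ (1 / q)) ^ q =
            ∑ j, |∑ i, ((r i j : ℤ) : ℝ)| ^ q := by
        intro r
        rw [← Real.rpow_mul (by positivity), one_div_mul_cancel hq0.ne', Real.rpow_one]
      simp only [h3]
      rw [← Finset.mul_sum, Finset.sum_comm]
      have h4 : T⁻¹ * ∑ j, ∑ r : Fin M → Fin N → ℤˣ, |∑ i, ((r i j : ℤ) : ℝ)| ^ q ≤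
          C * N * (√M) ^ q := by
        rw [inv_mul_le_iff₀ hTpos]
        calc _ ≤ ∑ _j : Fin N, T * (C * (√M) ^ q) :=
              Finset.sum_le_sum fun j _ => sum_abs_sum_signs_rpow_le hq0.le hM j
          _ = _ := by simp; ring
      calc _ ≤ (C * N * (√M) ^ q) ^ (1 / q) := by gcongr
        _ = B := by
          rw [Real.mul_rpow (by positivity) (by positivity), Real.mul_rpow hC0 (by positivity),
            ← Real.rpow_mul (by positivity), mul_one_div_cancel hq0.ne', Real.rpow_one]
    rw [← Finset.mul_sum, inv_mul_le_iff₀ hTpos] at h2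
    calc _ ≤ ∑ r : Fin M → Fin N → ℤˣ, 2 * (∑ j, |∑ i, ((r i j : ℤ) : ℝ)| ^ q) ^ (1 / q) :=
          Finset.sum_le_sum fun r _ => h1 r
      _ ≤ _ := by rw [← Finset.mul_sum]; linarith
  have hex : ∑ r : Fin M → Fin N → ℤˣ, (⨆ z, (0 + ∑ i,
      ((∑ r', |b r' z|) / Fintype.card (Fin N → ℤˣ) - |b (r i) z|))) ≤
      ∑ _r : Fin M → Fin N → ℤˣ, 2 * B := by
    refine main.trans (hright.trans (le_of_eq ?_))
    rw [Finset.sum_const, Finset.card_univ, nsmul_eq_mul]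
  obtain ⟨r, -, hr⟩ := Finset.exists_le_of_sum_le Finset.univ_nonempty hex
  refine ⟨r, fun z hz h0 => ?_⟩
  have hbd : BddAbove (Set.range fun z => (0 + ∑ i,
      ((∑ r', |b r' z|) / Fintype.card (Fin N → ℤˣ) - |b (r i) z|))) := by
    refine ⟨∑ _i : Fin M, (∑ _v : Fin N → ℤˣ, (N : ℝ) ^ (1 / q)) / Fintype.card (Fin N → ℤˣ), ?_⟩
    rintro _ ⟨w, rfl⟩
    simp only [zero_add]
    refine Finset.sum_le_sum fun i _ => (sub_le_self _ (abs_nonneg _)).trans ?_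
    gcongr
    exact hbdd _ w
  have h1 := (le_ciSup hbd ⟨z, hz⟩).trans hr
  have h2 := sqrt_le_mean_abs_signSum z
  have h3 : (M : ℝ) * (√(∑ j, z j ^ 2) / 2) ≤ 2 * B := by
    refine le_trans ?_ h1
    simp only [hb, h0, abs_zero, sub_zero, zero_add, Finset.sum_const, Finset.card_univ,
      Fintype.card_fin, nsmul_eq_mul] at h2 ⊢
    gcongr
  have hs : √(M : ℝ) * √M = M := Real.mul_self_sqrt hMpos.le
  have hspos : 0 < √(M : ℝ) := Real.sqrt_pos.2 hMpos
  rw [le_div_iff₀ hspos]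
  refine le_of_mul_le_mul_right ?_ hspos
  rw [mul_assoc, hs]
  rw [hB] at h3
  linarith

theorem lpNorm_eq_norm_toLp {p : ℝ≥0∞} (hp : p ≠ ∞) (hp0 : 0 < p.toReal) {N : ℕ}
    (x : Fin N → ℂ) : lpNorm p x = ‖WithLp.toLp p x‖ := by
  rw [lpNorm, if_neg hp, PiLp.norm_eq_sum hp0]

theorem exists_submodule_lpNorm_sub_le {p : ℝ≥0∞} (hp : p ≠ ∞) (hp1 : 1 ≤ p) :
    ∃ D : ℝ, 0 < D ∧ ∀ N M : ℕ, 1 ≤ M → ∃ L : Submodule ℂ (Fin N → ℂ),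
      Module.finrank ℂ L ≤ M ∧ ∀ x : Fin N → ℂ, ∃ y ∈ L, lpNorm p (x - y) ≤
        D * ((N : ℝ) ^ (1 / p.toReal) / √M) * √(∑ i, ‖x i‖ ^ 2) := by
  have hq : 1 ≤ p.toReal := by
    rwa [← ENNReal.toReal_one, ENNReal.toReal_le_toReal ENNReal.one_ne_top hp]
  have hq0 : 0 < p.toReal := by linarith
  have : Fact (1 ≤ p) := ⟨hp1⟩
  set q := p.toReal
  set C : ℝ := 4 * ((⌈q⌉₊.factorial : ℝ) * (2 * Real.exp (1 / 2))) ^ (1 / q) with hC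
  have hC0 : 0 < C := by positivity
  refine ⟨4 * C, by positivity, fun N M hM => ?_⟩
  have hMpos : (0 : ℝ) < M := by exact_mod_cast hM
  obtain ⟨r, hr⟩ := exists_signs_sqrt_le hq N hM
  rw [← hC] at hr
  set ρ : Fin M → Fin N → ℂ := fun i j => (((r i j : ℤ) : ℝ) : ℂ) with hρ
  set L := Submodule.span ℂ (Set.range ρ) with hL
  refine ⟨L, (finrank_range_le_card ρ).trans (by simp), fun x => ?_⟩
  rcases eq_or_ne x 0 with rfl | hx
  · refine ⟨0, L.zero_mem, ?_⟩
    simp [lpNorm_eq_norm_toLp hp hq0]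
  set σ := √(∑ i, ‖x i‖ ^ 2) with hσ
  have hσ0 : 0 < σ := by
    obtain ⟨i, hi⟩ := Function.ne_iff.1 hx
    refine Real.sqrt_pos.2 (Finset.sum_pos' (fun i _ => by positivity) ⟨i, Finset.mem_univ i, ?_⟩)
    have : 0 < ‖x i‖ := norm_pos_iff.2 hi
    positivity
  have hNpos : (0 : ℝ) < N := by
    obtain ⟨i, hi⟩ := Function.ne_iff.1 hx
    exact_mod_cast i.pos
  set R : ℝ := C * (N : ℝ) ^ (1 / q) / √M with hR
  have hR0 : 0 < R := by positivity
  set Λ : Submodule ℂ (PiLp p fun _ : Fin N => ℂ) :=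
    L.comap (WithLp.linearEquiv p ℂ (Fin N → ℂ)).toLinearMap with hΛ
  have : IsClosed (Λ : Set (PiLp p fun _ : Fin N => ℂ)) := Λ.closed_of_finiteDimensional
  obtain ⟨g, hg1, hgx⟩ := exists_dual_vector'' ℂ (Λ.mkQ (WithLp.toLp p x))
  set φ : (Fin N → ℂ) → ℂ := fun y => g (Λ.mkQ (WithLp.toLp p y)) with hφ
  set z : Fin N → ℂ := fun j => φ (Pi.single j 1) with hz
  have hφsum : ∀ y, φ y = ∑ j, z j * y j := by
    intro y
    have hl : y = ∑ j, y j • (Pi.single j (1 : ℂ) : Fin N → ℂ) := pi_eq_sum_univ' y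
    conv_lhs => rw [hl]
    simp only [hφ, hz, WithLp.toLp_sum, WithLp.toLp_smul, map_sum, map_smul, smul_eq_mul, mul_comm]
  have hφle : ∀ y, ‖φ y‖ ≤ lpNorm p y := by
    intro y
    rw [lpNorm_eq_norm_toLp hp hq0]
    calc ‖φ y‖ ≤ ‖g‖ * ‖Λ.mkQ (WithLp.toLp p y)‖ := g.le_opNorm _
      _ ≤ 1 * ‖Λ.mkQ (WithLp.toLp p y)‖ := by gcongr
      _ ≤ _ := by rw [one_mul]; exact Submodule.Quotient.norm_mk_le Λ _
  have hφL : ∀ i, φ (ρ i) = 0 := by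
    intro i
    have : Λ.mkQ (WithLp.toLp p (ρ i)) = 0 := by
      rw [Submodule.mkQ_apply, Submodule.Quotient.mk_eq_zero]
      exact Submodule.subset_span ⟨i, rfl⟩
    simp only [hφ, this, map_zero]
  have hpart : ∀ (f : ℂ →ₗ[ℝ] ℝ), (∀ w, f w ≤ ‖w‖) → √(∑ j, f (z j) ^ 2) ≤ R := by
    intro f hf
    have hfs : ∀ y : Fin N → ℝ, ∑ j, f (z j) * y j = f (φ fun j => (y j : ℂ)) := by
      intro y
      rw [hφsum, map_sum]
      refine Finset.sum_congr rfl fun j _ => ?_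
      rw [mul_comm (z j), ← Complex.real_smul, map_smul, smul_eq_mul, mul_comm]
    refine hr (fun j => f (z j)) (fun y => ?_) fun i => ?_
    · rw [hfs]
      refine (hf _).trans ((hφle _).trans ?_)
      rw [lpNorm, if_neg hp]
      simp [q]
    · have h := hfs fun j => ((r i j : ℤ) : ℝ)
      rw [signSum]
      simp only [mul_comm] at h ⊢
      rw [h]
      have := hφL i
      simp only [hρ] at this
      rw [this, map_zero]
  have hre := hpart Complex.reLm Complex.re_le_norm
  have him := hpart Complex.imLm Complex.im_le_norm
  have hznorm : √(∑ j, ‖z j‖ ^ 2) ≤ 2 * R := by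
    rw [Real.sqrt_le_left (by positivity)] at hre him ⊢
    have : ∑ j, ‖z j‖ ^ 2 = ∑ j, (z j).re ^ 2 + ∑ j, (z j).im ^ 2 := by
      rw [← Finset.sum_add_distrib]
      refine Finset.sum_congr rfl fun j _ => ?_
      rw [Complex.sq_norm, Complex.normSq_apply]
      ring
    rw [this]
    simp only [Complex.reLm_coe, Complex.imLm_coe] at hre him
    nlinarith
  have hquot : ‖Λ.mkQ (WithLp.toLp p x)‖ ≤ 2 * R * σ := by
    have h1 : ‖Λ.mkQ (WithLp.toLp p x)‖ = ‖φ x‖ := by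
      simp only [hφ, hgx]
      simp
    rw [h1, hφsum]
    calc _ ≤ ∑ j, ‖z j‖ * ‖x j‖ := (norm_sum_le _ _).trans (by simp)
      _ ≤ √(∑ j, ‖z j‖ ^ 2) * σ := Real.sum_mul_le_sqrt_mul_sqrt _ _ _
      _ ≤ _ := by gcongr
  have hlt : ‖Λ.mkQ (WithLp.toLp p x)‖ < 4 * R * σ := by
    have : 0 < R * σ := by positivity
    linarith
  obtain ⟨w, hw, hwlt⟩ := Submodule.Quotient.norm_mk_lt (Λ.mkQ (WithLp.toLp p x)) (sub_pos.2 hlt)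
  rw [add_sub_cancel, ← WithLp.toLp_ofLp p w] at hwlt
  refine ⟨x - WithLp.ofLp w, ?_, ?_⟩
  · rw [Submodule.mkQ_apply, eq_comm, Submodule.Quotient.eq] at hw
    exact hw
  · rw [sub_sub_cancel, lpNorm_eq_norm_toLp hp hq0]
    refine hwlt.le.trans (le_of_eq ?_)
    rw [hR]
    ring

end Upper

section KolmogorovNumbers

theorem lpNorm_le_iff {p : ℝ≥0∞} (hp : p ≠ ∞) (hp0 : 0 < p.toReal) {N : ℕ} (x : Fin N → ℂ)
    {c : ℝ} (hc : 0 ≤ c) : lpNorm p x ≤ c ↔ ∑ i, ‖x i‖ ^ p.toReal ≤ c ^ p.toReal := by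
  rw [lpNorm, if_neg hp, one_div, Real.rpow_inv_le_iff_of_pos (by positivity) hc hp0]

theorem sum_rpow_le_of_lpNorm_le_one {p : ℝ≥0∞} (hp : p ≠ ∞) (hp0 : 0 < p.toReal) {N : ℕ}
    {x : Fin N → ℂ} (hx : lpNorm p x ≤ 1) : ∑ i, ‖x i‖ ^ p.toReal ≤ 1 := by
  simpa using (lpNorm_le_iff hp hp0 x zero_le_one).1 hx

theorem lpNorm_le_one_of_le {p1 p2 : ℝ≥0∞} (hp1 : p1 ≠ ∞) (hp2 : p2 ≠ ∞) (h0 : 0 < p1.toReal)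
    (h12 : p1.toReal ≤ p2.toReal) {N : ℕ} {x : Fin N → ℂ} (hx : lpNorm p1 x ≤ 1) :
    lpNorm p2 x ≤ 1 := by
  have hs := sum_rpow_le_of_lpNorm_le_one hp1 h0 hx
  rw [lpNorm_le_iff hp2 (h0.trans_le h12) x zero_le_one, Real.one_rpow]
  refine (Finset.sum_le_sum fun i _ => ?_).trans hs
  have hi : ‖x i‖ ^ p1.toReal ≤ 1 :=
    (Finset.single_le_sum (f := fun i => ‖x i‖ ^ p1.toReal) (fun i _ => by positivity)
      (Finset.mem_univ i)).trans hs
  have hi1 : ‖x i‖ ≤ 1 := by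
    by_contra! h
    exact absurd hi (not_le.2 (Real.one_lt_rpow h h0))
  exact Real.rpow_le_rpow_of_exponent_ge_of_imp (norm_nonneg _) hi1 h12 (fun _ h => by linarith)

theorem kolmogorovLp_le {p1 p2 : ℝ≥0∞} (hp2 : p2 ≠ ∞) {N n : ℕ} {B : ℝ} (hB : 0 ≤ B)
    (L : Submodule ℂ (Fin N → ℂ)) (hL : Module.finrank ℂ L < n)
    (h : ∀ x : Fin N → ℂ, lpNorm p1 x ≤ 1 → ∃ y ∈ L, lpNorm p2 (x - y) ≤ B) :
    kolmogorovLp p1 p2 N n ≤ B := by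
  have hinf : ∀ (L' : Submodule ℂ (Fin N → ℂ)) (x : Fin N → ℂ),
      0 ≤ sInf { s : ℝ | ∃ y ∈ L', s = lpNorm p2 (x - y) } := by
    intro L' x
    refine Real.sInf_nonneg ?_
    rintro _ ⟨y, -, rfl⟩
    exact lpNorm_nonneg hp2 _
  unfold kolmogorovLp
  refine le_trans (csInf_le ⟨0, ?_⟩ ⟨L, hL, rfl⟩) (Real.sSup_le ?_ hB)
  · rintro _ ⟨L', -, rfl⟩
    refine Real.sSup_nonneg ?_
    rintro _ ⟨x, -, rfl⟩
    exact hinf L' x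
  · rintro _ ⟨x, hx, rfl⟩
    obtain ⟨y, hy, hxy⟩ := h x hx
    refine le_trans (csInf_le ⟨0, ?_⟩ ⟨y, hy, rfl⟩) hxy
    rintro _ ⟨y, -, rfl⟩
    exact lpNorm_nonneg hp2 _

theorem le_kolmogorovLp {p1 p2 : ℝ≥0∞} (hp1 : p1 ≠ ∞) (hp2 : p2 ≠ ∞) (h0 : 0 < p1.toReal)
    (h12 : p1.toReal ≤ p2.toReal) {N n : ℕ} (hn : 1 ≤ n) {B : ℝ}
    (h : ∀ L : Submodule ℂ (Fin N → ℂ), Module.finrank ℂ L < n →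
      ∃ x : Fin N → ℂ, lpNorm p1 x ≤ 1 ∧ ∀ y ∈ L, B ≤ lpNorm p2 (x - y)) :
    B ≤ kolmogorovLp p1 p2 N n := by
  refine le_csInf ⟨_, ⊥, by rw [finrank_bot]; omega, rfl⟩ ?_
  rintro _ ⟨L, hL, rfl⟩
  obtain ⟨x, hx, hxB⟩ := h L hL
  have hle : B ≤ sInf { s : ℝ | ∃ y ∈ L, s = lpNorm p2 (x - y) } := by
    refine le_csInf ⟨_, 0, L.zero_mem, rfl⟩ ?_
    rintro _ ⟨y, hy, rfl⟩
    exact hxB y hy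
  refine hle.trans (le_csSup ⟨1, ?_⟩ ⟨x, hx, rfl⟩)
  rintro _ ⟨w, hw, rfl⟩
  refine le_trans (csInf_le ⟨0, ?_⟩ ⟨0, L.zero_mem, rfl⟩) ?_
  · rintro _ ⟨y, -, rfl⟩
    exact lpNorm_nonneg hp2 _
  · rw [sub_zero]
    exact lpNorm_le_one_of_le hp1 hp2 h0 h12 hw

/-- Splitting a vector of the unit ball of `ℓ_{p1}` at height `τ` into a part that is small in
`ℓ_2` and a part that is small in `ℓ_{p2}`. -/
theorem exists_lpNorm_sub_le_of_split {p1 p2 : ℝ≥0∞} (hp1 : p1 ≠ ∞) (hp2 : p2 ≠ ∞)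
    (h2 : 2 ≤ p1.toReal) (h12 : p1.toReal ≤ p2.toReal) (hp21 : 1 ≤ p2) {N : ℕ}
    (L : Submodule ℂ (Fin N → ℂ)) {D : ℝ} (hD : 0 ≤ D)
    (h : ∀ x : Fin N → ℂ, ∃ y ∈ L, lpNorm p2 (x - y) ≤ D * √(∑ i, ‖x i‖ ^ 2))
    {τ : ℝ} (hτ : 0 < τ) (x : Fin N → ℂ) (hx : lpNorm p1 x ≤ 1) :
    ∃ y ∈ L, lpNorm p2 (x - y) ≤
      D * τ ^ (1 - p1.toReal / 2) + τ ^ (1 - p1.toReal / p2.toReal) := by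
  have : Fact (1 ≤ p2) := ⟨hp21⟩
  set a := p1.toReal
  set q := p2.toReal
  have ha0 : 0 < a := by linarith
  have hq0 : 0 < q := by linarith
  have hs := sum_rpow_le_of_lpNorm_le_one hp1 ha0 hx
  set u : Fin N → ℂ := fun i => if τ < ‖x i‖ then x i else 0 with hu
  set v : Fin N → ℂ := fun i => if τ < ‖x i‖ then 0 else x i with hv
  have hxuv : x = u + v := by
    ext i
    simp only [hu, hv, Pi.add_apply]
    split_ifs <;> simp
  have hu2 : √(∑ i, ‖u i‖ ^ 2) ≤ τ ^ (1 - a / 2) := by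
    rw [Real.sqrt_le_left (by positivity), ← Real.rpow_natCast, ← Real.rpow_mul hτ.le]
    calc ∑ i, ‖u i‖ ^ 2 ≤ ∑ i, τ ^ (2 - a) * ‖x i‖ ^ a := by
          refine Finset.sum_le_sum fun i _ => ?_
          simp only [hu]
          split_ifs with hi
          · have hxi : 0 < ‖x i‖ := hτ.trans hi
            calc ‖x i‖ ^ 2 = ‖x i‖ ^ (2 - a) * ‖x i‖ ^ a := by
                  rw [← Real.rpow_add hxi, sub_add_cancel, Real.rpow_two]
              _ ≤ _ := by
                  gcongr ?_ * _
                  exact Real.rpow_le_rpow_of_nonpos hτ hi.le (by linarith)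
          · rw [norm_zero, zero_pow two_ne_zero]
            positivity
      _ ≤ τ ^ (2 - a) * 1 := by rw [← Finset.mul_sum]; gcongr
      _ = _ := by rw [mul_one]; congr 1; push_cast; ring
  have hvq : lpNorm p2 v ≤ τ ^ (1 - a / q) := by
    rw [lpNorm_le_iff hp2 hq0 v (by positivity), ← Real.rpow_mul hτ.le]
    calc ∑ i, ‖v i‖ ^ q ≤ ∑ i, τ ^ (q - a) * ‖x i‖ ^ a := by
          refine Finset.sum_le_sum fun i _ => ?_
          simp only [hv]
          split_ifs with hi
          · rw [norm_zero, Real.zero_rpow hq0.ne']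
            positivity
          · rcases (norm_nonneg (x i)).eq_or_lt with h0 | hxi
            · rw [← h0, Real.zero_rpow hq0.ne', Real.zero_rpow ha0.ne', mul_zero]
            calc ‖x i‖ ^ q = ‖x i‖ ^ (q - a) * ‖x i‖ ^ a := by
                  rw [← Real.rpow_add hxi, sub_add_cancel]
              _ ≤ _ := by
                  gcongr ?_ * _
                  exact Real.rpow_le_rpow hxi.le (not_lt.1 hi) (by linarith)
      _ ≤ τ ^ (q - a) * 1 := by rw [← Finset.mul_sum]; gcongr
      _ = _ := by rw [mul_one]; congr 1; change q - a = (1 - a / q) * q; field_simp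
  obtain ⟨y, hy, hyu⟩ := h u
  refine ⟨y, hy, ?_⟩
  have htri : lpNorm p2 (x - y) ≤ lpNorm p2 (u - y) + lpNorm p2 v := by
    rw [show x - y = (u - y) + v by rw [hxuv]; abel]
    simp only [lpNorm_eq_norm_toLp hp2 hq0, WithLp.toLp_add]
    exact norm_add_le _ _
  calc _ ≤ lpNorm p2 (u - y) + lpNorm p2 v := htri
    _ ≤ _ := by
      gcongr
      exact hyu.trans (by gcongr)

theorem exists_kolmogorovLp_le {p1 p2 : ℝ≥0∞} (hp1 : p1 ≠ ∞) (hp2 : p2 ≠ ∞)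
    (h2 : 2 ≤ p1.toReal) (h12 : p1.toReal < p2.toReal) (hp21 : 1 ≤ p2) :
    ∃ c : ℝ, 0 < c ∧ ∀ N n : ℕ, 1 ≤ n → n ≤ N → kolmogorovLp p1 p2 N n ≤
        c * min 1 ((N : ℝ) ^ (1 / p2.toReal) * (n : ℝ) ^ (-(1 : ℝ) / 2)) ^
          ((1 / p1.toReal - 1 / p2.toReal) / (1 / 2 - 1 / p2.toReal)) := by
  obtain ⟨D, hD, hDL⟩ := exists_submodule_lpNorm_sub_le hp2 hp21
  set a := p1.toReal with ha
  set q := p2.toReal with hq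
  have ha0 : 0 < a := by linarith
  have hq0 : 0 < q := by linarith
  have hgap : 0 < 1 / 2 - 1 / q := by
    rw [sub_pos]
    exact one_div_lt_one_div_of_lt two_pos (by linarith)
  refine ⟨2 * D + 1, by positivity, fun N n hn hnN => ?_⟩
  have hn0 : (0 : ℝ) < n := by exact_mod_cast hn
  have hN0 : (0 : ℝ) < N := by exact_mod_cast hn.trans hnN
  set η : ℝ := (N : ℝ) ^ (1 / q) * (n : ℝ) ^ (-(1 : ℝ) / 2) with hη
  have hη0 : 0 < η := by positivity
  rcases le_or_gt 1 η with h1 | h1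
  · rw [min_eq_left h1, Real.one_rpow]
    refine kolmogorovLp_le hp2 (by positivity) ⊥ (by rw [finrank_bot]; omega) fun x hx =>
      ⟨0, Submodule.zero_mem _, ?_⟩
    rw [sub_zero]
    have := lpNorm_le_one_of_le hp1 hp2 ha0 h12.le hx
    linarith
  rw [min_eq_right h1.le]
  have hn2 : 2 ≤ n := by
    by_contra! hlt
    have : n = 1 := by omega
    subst this
    have : 1 ≤ (N : ℝ) ^ (1 / q) := Real.one_le_rpow (by exact_mod_cast hnN) (by positivity)
    simp only [hη, Nat.cast_one, Real.one_rpow, mul_one] at h1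
    linarith
  obtain ⟨L, hL, hLx⟩ := hDL N (n - 1) (by omega)
  have hDη : D * ((N : ℝ) ^ (1 / q) / √(n - 1 : ℕ)) ≤ 2 * D * η := by
    have hn1 : (n : ℝ) ≤ 4 * ((n - 1 : ℕ) : ℝ) := by exact_mod_cast (by omega : n ≤ 4 * (n - 1))
    have hsq : √(n : ℝ) ≤ 2 * √((n - 1 : ℕ) : ℝ) := by
      rw [Real.sqrt_le_left (by positivity), mul_pow, Real.sq_sqrt (by positivity)]
      linarith
    have hspos : 0 < √(n : ℝ) := Real.sqrt_pos.2 hn0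
    have hn' : (n : ℝ) ^ (-(1 : ℝ) / 2) = (√(n : ℝ))⁻¹ := by
      rw [neg_div, Real.rpow_neg hn0.le, ← Real.sqrt_eq_rpow]
    rw [hη, hn']
    have hinv : (√((n - 1 : ℕ) : ℝ))⁻¹ ≤ 2 * (√(n : ℝ))⁻¹ := by
      have hpos : 0 < √((n - 1 : ℕ) : ℝ) := by linarith
      rw [← div_eq_mul_inv, inv_eq_one_div, div_le_div_iff₀ hpos hspos]
      linarith
    calc _ = D * (N : ℝ) ^ (1 / q) * (√((n - 1 : ℕ) : ℝ))⁻¹ := by ring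
      _ ≤ D * (N : ℝ) ^ (1 / q) * (2 * (√(n : ℝ))⁻¹) := by gcongr
      _ = _ := by ring
  refine kolmogorovLp_le hp2 (by positivity) L (by omega) fun x hx => ?_
  set τ : ℝ := η ^ (1 / (a * (1 / 2 - 1 / q))) with hτ
  have hτ0 : 0 < τ := by positivity
  obtain ⟨y, hy, hxy⟩ := exists_lpNorm_sub_le_of_split hp1 hp2 h2 h12.le hp21 L
    (D := 2 * D * η) (by positivity) (fun w => by
      obtain ⟨y, hy, hwy⟩ := hLx w
      exact ⟨y, hy, hwy.trans (by gcongr)⟩) hτ0 x hx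
  refine ⟨y, hy, hxy.trans (le_of_eq ?_)⟩
  have hg : (q - 2) ≠ 0 := by linarith
  have hg' : (1 / 2 - 1 / q) = (q - 2) / (2 * q) := by field_simp
  have e1 : τ ^ (1 - a / q) = η ^ ((1 / a - 1 / q) / (1 / 2 - 1 / q)) := by
    rw [hτ, ← Real.rpow_mul hη0.le]
    congr 1
    rw [hg']
    field_simp
  have e2 : η * τ ^ (1 - a / 2) = η ^ ((1 / a - 1 / q) / (1 / 2 - 1 / q)) := by
    rw [hτ, ← Real.rpow_mul hη0.le]
    nth_rewrite 1 [← Real.rpow_one η]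
    rw [← Real.rpow_add hη0]
    congr 1
    rw [hg']
    field_simp
    ring
  rw [← ha, ← hq, e1, mul_assoc (2 * D), e2]
  ring

end KolmogorovNumbers

section Lower

theorem rpow_sum_le_card_rpow_mul {ι : Type*} (S : Finset ι) (f : ι → ℝ) (hf : ∀ i, 0 ≤ f i)
    {s q : ℝ} (hs : 0 < s) (hsq : s ≤ q) :
    (∑ i ∈ S, f i ^ s) ^ (1 / s) ≤
      (S.card : ℝ) ^ (1 / s - 1 / q) * (∑ i ∈ S, f i ^ q) ^ (1 / q) := by
  have hq : 0 < q := hs.trans_le hsq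
  have hfs : ∀ r : ℝ, 0 ≤ ∑ i ∈ S, f i ^ r := fun r =>
    Finset.sum_nonneg fun i _ => Real.rpow_nonneg (hf i) r
  have h := Real.rpow_sum_le_const_mul_sum_rpow S (fun i => f i ^ s)
    (p := q / s) ((one_le_div hs).2 hsq)
  have h1 : ∀ i, |f i ^ s| = f i ^ s := fun i => abs_of_nonneg (Real.rpow_nonneg (hf i) s)
  have h2 : ∀ i, (f i ^ s) ^ (q / s) = f i ^ q := fun i => by
    rw [← Real.rpow_mul (hf i), mul_div_cancel₀ _ hs.ne']
  simp only [h1, h2] at h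
  have h3 := Real.rpow_le_rpow (Real.rpow_nonneg (hfs s) _) h (one_div_nonneg.2 hq.le)
  rw [← Real.rpow_mul (hfs s), Real.mul_rpow (by positivity) (hfs q),
    ← Real.rpow_mul (Nat.cast_nonneg _)] at h3
  convert h3 using 2
  · field_simp
  · congr 1; field_simp

theorem exists_finset_card_eq_sum_le {N k : ℕ} (hk : k ≤ N) (w : Fin N → ℝ) :
    ∃ S : Finset (Fin N), S.card = k ∧ N * ∑ i ∈ S, w i ≤ k * ∑ i, w i := by
  rcases Nat.eq_zero_or_pos N with rfl | hN
  · exact ⟨∅, by simp; omega, by simp⟩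
  have : NeZero N := ⟨hN.ne'⟩
  set J : Finset (Fin N) := Finset.univ.filter fun j => j.val < k with hJ
  have hJc : J.card = k := by
    rw [hJ, Fin.card_filter_val_lt]
    omega
  have hsum : ∑ s : Fin N, N * ∑ j ∈ J, w (s + j) = ∑ _s : Fin N, k * ∑ i, w i := by
    rw [← Finset.mul_sum, Finset.sum_comm]
    have : ∀ j : Fin N, ∑ s, w (s + j) = ∑ i, w i := fun j =>
      Equiv.sum_comp (Equiv.addRight j) w
    simp [this, hJc]
  obtain ⟨s, -, hs⟩ := Finset.exists_le_of_sum_le Finset.univ_nonempty hsum.le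
  refine ⟨J.map (Equiv.addLeft s).toEmbedding, by rw [Finset.card_map, hJc], ?_⟩
  rw [Finset.sum_map]
  exact hs

theorem exists_norm_one_norm_sum_sq_le {ι E : Type*} [NormedAddCommGroup E]
    [InnerProductSpace ℂ E] (v : ι → E) (S : Finset ι) :
    ∃ σ : ι → ℂ, (∀ i, ‖σ i‖ = 1) ∧ ‖∑ i ∈ S, σ i • v i‖ ^ 2 ≤ ∑ i ∈ S, ‖v i‖ ^ 2 := by
  induction S using Finset.induction_on with
  | empty => exact ⟨fun _ => 1, by simp, by simp⟩
  | insert a S ha ih =>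
    obtain ⟨σ, hσ, hle⟩ := ih
    have hpar := parallelogram_law_with_norm ℂ (v a) (∑ i ∈ S, σ i • v i)
    have key : ∀ ε : ℂ, ‖ε‖ = 1 →
        ‖ε • v a + ∑ i ∈ S, σ i • v i‖ ^ 2 ≤ ‖v a‖ ^ 2 + ‖∑ i ∈ S, σ i • v i‖ ^ 2 →
        ∃ σ : ι → ℂ, (∀ i, ‖σ i‖ = 1) ∧
          ‖∑ i ∈ insert a S, σ i • v i‖ ^ 2 ≤ ∑ i ∈ insert a S, ‖v i‖ ^ 2 := by
      intro ε hε h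
      refine ⟨Function.update σ a ε, fun i => ?_, ?_⟩
      · rcases eq_or_ne i a with rfl | hi
        · simpa using hε
        · simpa [hi] using hσ i
      · rw [Finset.sum_insert ha, Finset.sum_insert ha, Function.update_self,
          Finset.sum_congr rfl fun i hi => by
            rw [Function.update_of_ne (ne_of_mem_of_not_mem hi ha)]]
        linarith
    rcases le_total ‖v a + ∑ i ∈ S, σ i • v i‖ ‖v a - ∑ i ∈ S, σ i • v i‖ with h | h
    · refine key 1 (by simp) ?_
      rw [one_smul]
      nlinarith [norm_nonneg (v a + ∑ i ∈ S, σ i • v i)]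
    · refine key (-1) (by simp) ?_
      rw [neg_one_smul, show -v a + ∑ i ∈ S, σ i • v i = -(v a - ∑ i ∈ S, σ i • v i) by abel,
        norm_neg]
      nlinarith [norm_nonneg (v a - ∑ i ∈ S, σ i • v i)]

theorem sum_norm_starProjection_basis_sq {ι E : Type*} [Fintype ι] [NormedAddCommGroup E]
    [InnerProductSpace ℂ E] [FiniteDimensional ℂ E] (e : OrthonormalBasis ι ℂ E)
    (U : Submodule ℂ E) : ∑ i, ‖U.starProjection (e i)‖ ^ 2 = Module.finrank ℂ U := by
  set b := stdOrthonormalBasis ℂ U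
  have h : ∀ i, ‖U.starProjection (e i)‖ ^ 2 = ∑ l, ‖inner ℂ (b l : E) (e i)‖ ^ 2 := by
    intro i
    have := b.sum_sq_norm_inner_right (U.orthogonalProjectionOnto (e i))
    rw [Submodule.starProjection_apply, ← Submodule.coe_norm, ← this]
    refine Finset.sum_congr rfl fun l _ => ?_
    rw [Submodule.inner_orthogonalProjectionOnto_eq_of_mem_left]
  simp only [h]
  rw [Finset.sum_comm]
  have h2 : ∀ l, ∑ i, ‖inner ℂ (b l : E) (e i)‖ ^ 2 = 1 := by
    intro l
    rw [e.sum_sq_norm_inner_left, Submodule.norm_coe, b.norm_eq_one]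
    norm_num
  simp [h2]

/-- Every subspace of small dimension is far, in `ℓ_p`, from some vector with `k` unimodular
entries and zeros elsewhere. -/
theorem exists_flat_vector_far {p : ℝ≥0∞} (hp : p ≠ ∞) (hp2 : 2 ≤ p.toReal) {N n k : ℕ}
    (hn : 2 * n ≤ N) (hk : 1 ≤ k) (hkN : k ≤ N) (L : Submodule ℂ (Fin N → ℂ))
    (hL : Module.finrank ℂ L ≤ n) :
    ∃ x : Fin N → ℂ, (∀ a : ℝ, 0 < a → ∑ i, ‖x i‖ ^ a = k) ∧ ∀ y ∈ L,
      (k : ℝ) / 2 ≤ lpNorm p (x - y) * ((k : ℝ) ^ (1 - 1 / p.toReal) +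
        (N : ℝ) ^ (-(1 / p.toReal)) * (√k * √n)) := by
  set q := p.toReal with hq
  have hN0 : (0 : ℝ) < N := by exact_mod_cast (by omega : 0 < N)
  set U : Submodule ℂ (EuclideanSpace ℂ (Fin N)) :=
    L.comap (WithLp.linearEquiv 2 ℂ (Fin N → ℂ)).toLinearMap with hU
  have hUd : Module.finrank ℂ U ≤ n := by
    have : Module.finrank ℂ U = Module.finrank ℂ L := by
      rw [hU, Submodule.comap_equiv_eq_map_symm, LinearEquiv.finrank_map_eq]
    omega
  set e := EuclideanSpace.basisFun (Fin N) ℂ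
  obtain ⟨S, hSc, hS⟩ := exists_finset_card_eq_sum_le hkN fun i => ‖U.starProjection (e i)‖ ^ 2
  rw [sum_norm_starProjection_basis_sq] at hS
  obtain ⟨σ, hσ, hσle⟩ := exists_norm_one_norm_sum_sq_le (fun i => U.starProjection (e i)) S
  set X : EuclideanSpace ℂ (Fin N) := ∑ i ∈ S, σ i • e i with hX
  have hPX : N * ‖U.starProjection X‖ ^ 2 ≤ k * n := by
    have h1 : U.starProjection X = ∑ i ∈ S, σ i • U.starProjection (e i) := by simp [hX]
    rw [h1]
    calc _ ≤ N * ∑ i ∈ S, ‖U.starProjection (e i)‖ ^ 2 := by gcongr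
      _ ≤ k * Module.finrank ℂ U := hS
      _ ≤ _ := by gcongr
  have hXi : ∀ i, X i = if i ∈ S then σ i else 0 := by
    intro i
    simp [hX, e, Pi.single_apply, WithLp.ofLp_sum]
  have hXa : ∀ a : ℝ, 0 < a → ∑ i, ‖X i‖ ^ a = k := by
    intro a ha
    have : ∀ i, ‖X i‖ ^ a = if i ∈ S then 1 else 0 := by
      intro i
      rw [hXi]
      split_ifs <;> simp [hσ, ha.ne']
    simp [this, hSc]
  refine ⟨WithLp.ofLp X, hXa, fun y hy => ?_⟩
  set Y : EuclideanSpace ℂ (Fin N) := WithLp.toLp 2 y with hY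
  have hYU : Y ∈ U := hy
  set Z := X - Y with hZ
  set δ := lpNorm p (WithLp.ofLp X - y) with hδ
  have hδeq : δ = (∑ i, ‖Z i‖ ^ q) ^ (1 / q) := by
    rw [hδ, lpNorm, if_neg hp]
    rfl
  have hδ0 : 0 ≤ δ := lpNorm_nonneg hp _
  have hXn : ‖X‖ ^ 2 = k := by
    rw [EuclideanSpace.norm_sq_eq, ← hXa 2 two_pos]
    simp
  have hXZ : ‖inner ℂ X Z‖ ≤ (k : ℝ) ^ (1 - 1 / q) * δ := by
    have h1 : inner ℂ X Z = ∑ i ∈ S, inner ℂ (σ i) (Z i) := by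
      rw [PiLp.inner_apply, ← Finset.sum_subset (Finset.subset_univ S)]
      · exact Finset.sum_congr rfl fun i hi => by rw [hXi, if_pos hi]
      · intro i _ hi
        rw [hXi, if_neg hi, inner_zero_left]
    rw [h1]
    calc _ ≤ ∑ i ∈ S, ‖Z i‖ := (norm_sum_le _ _).trans (Finset.sum_le_sum fun i _ =>
            (norm_inner_le_norm _ _).trans (by rw [hσ, one_mul]))
      _ ≤ (k : ℝ) ^ (1 - 1 / q) * (∑ i ∈ S, ‖Z i‖ ^ q) ^ (1 / q) := by
        have := rpow_sum_le_card_rpow_mul S (fun i => ‖Z i‖) (fun i => norm_nonneg _)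
          one_pos (by linarith : 1 ≤ q)
        simpa [hSc] using this
      _ ≤ _ := by
        rw [hδeq]
        gcongr
        exact Finset.subset_univ S
  have hZn : ‖Z‖ ≤ (N : ℝ) ^ (1 / 2 - 1 / q) * δ := by
    have := rpow_sum_le_card_rpow_mul Finset.univ (fun i => ‖Z i‖) (fun i => norm_nonneg _)
      two_pos hp2
    rw [EuclideanSpace.norm_eq, Real.sqrt_eq_rpow, hδeq]
    simpa using this
  have hPn : ‖U.starProjection X‖ ≤ √k * √n / √N := by
    rw [le_div_iff₀ (Real.sqrt_pos.2 hN0), ← Real.sqrt_mul (Nat.cast_nonneg k)]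
    refine Real.le_sqrt_of_sq_le ?_
    rw [mul_pow, Real.sq_sqrt hN0.le]
    linarith
  have hPZ : ‖inner ℂ (U.starProjection X) Z‖ ≤
      (N : ℝ) ^ (-(1 / q)) * (√k * √n) * δ := by
    calc _ ≤ ‖U.starProjection X‖ * ‖Z‖ := norm_inner_le_norm _ _
      _ ≤ √k * √n / √N * ((N : ℝ) ^ (1 / 2 - 1 / q) * δ) := by gcongr
      _ = _ := by
        rw [sub_eq_add_neg, Real.rpow_add hN0, ← Real.sqrt_eq_rpow]
        have := (Real.sqrt_pos.2 hN0).ne'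
        field_simp
  have hid : (k : ℂ) - (‖U.starProjection X‖ : ℂ) ^ 2 =
      inner ℂ X Z - inner ℂ (U.starProjection X) Z := by
    have h1 := Submodule.starProjection_inner_eq_zero (K := U) X Y hYU
    have h2 := Submodule.starProjection_inner_eq_zero (K := U) X (U.starProjection X)
      (Submodule.starProjection_apply_mem U X)
    have h3 := inner_self_eq_norm_sq_to_K (𝕜 := ℂ) (U.starProjection X)
    have h4 := inner_self_eq_norm_sq_to_K (𝕜 := ℂ) X
    have h5 : inner ℂ (U.starProjection X) X = inner ℂ X (U.starProjection X) :=
      Submodule.inner_starProjection_left_eq_right U X X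
    rw [inner_sub_left] at h1 h2
    rw [hZ, inner_sub_right, inner_sub_right]
    have h6 : ((‖X‖ : ℂ)) ^ 2 = k := by exact_mod_cast congrArg (fun t : ℝ => (t : ℂ)) hXn
    have h3' : inner ℂ (U.starProjection X) (U.starProjection X) =
      (‖U.starProjection X‖ : ℂ) ^ 2 := h3
    have h4' : inner ℂ X X = (‖X‖ : ℂ) ^ 2 := h4
    rw [← h6, ← h4', ← h3']
    linear_combination h1 + h2 + h5
  have hle : (k : ℝ) - ‖U.starProjection X‖ ^ 2 ≤
      ‖inner ℂ X Z‖ + ‖inner ℂ (U.starProjection X) Z‖ := by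
    refine le_trans ?_ (norm_sub_le _ _)
    rw [← hid]
    have : (k : ℂ) - (‖U.starProjection X‖ : ℂ) ^ 2 =
        (((k : ℝ) - ‖U.starProjection X‖ ^ 2 : ℝ) : ℂ) := by push_cast; rfl
    rw [this, Complex.norm_real]
    exact le_abs_self _
  have hhalf : ‖U.starProjection X‖ ^ 2 ≤ k / 2 := by
    have h2n : (2 : ℝ) * n ≤ N := by exact_mod_cast hn
    have hk0 : (0 : ℝ) ≤ k := Nat.cast_nonneg k
    refine le_of_mul_le_mul_left ?_ hN0
    nlinarith
  rw [mul_add]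
  linarith

theorem le_kolmogorovLp_of_two_mul_le {p1 p2 : ℝ≥0∞} (hp1 : p1 ≠ ∞) (hp2 : p2 ≠ ∞)
    (h2 : 2 ≤ p1.toReal) (h12 : p1.toReal < p2.toReal) {N n : ℕ} (hn : 1 ≤ n) (hnN : 2 * n ≤ N) :
    min 1 ((N : ℝ) ^ (1 / p2.toReal) * (n : ℝ) ^ (-(1 : ℝ) / 2)) ^
      ((1 / p1.toReal - 1 / p2.toReal) / (1 / 2 - 1 / p2.toReal)) / 6 ≤
        kolmogorovLp p1 p2 N n := by
  set a := p1.toReal with ha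
  set q := p2.toReal with hq
  have ha0 : 0 < a := by linarith
  have hq0 : 0 < q := by linarith
  have hn0 : (0 : ℝ) < n := by exact_mod_cast hn
  have hN0 : (0 : ℝ) < N := by exact_mod_cast (by omega : 0 < N)
  have hgap : 0 < 1 / 2 - 1 / q := by
    rw [sub_pos]
    exact one_div_lt_one_div_of_lt two_pos (by linarith)
  have haq : 0 < 1 / a - 1 / q := by
    rw [sub_pos]
    exact one_div_lt_one_div_of_lt ha0 h12
  set γ := 1 / 2 - 1 / q with hγ
  have hsqrt : (n : ℝ) ^ (-(1 : ℝ) / 2) = (√(n : ℝ))⁻¹ := by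
    rw [neg_div, Real.rpow_neg hn0.le, ← Real.sqrt_eq_rpow]
  have hsn : 0 < √(n : ℝ) := Real.sqrt_pos.2 hn0
  set η : ℝ := (N : ℝ) ^ (1 / q) * (n : ℝ) ^ (-(1 : ℝ) / 2) with hη
  have hη0 : 0 < η := by positivity
  set ξ := min 1 η with hξ
  have hξ0 : 0 < ξ := lt_min one_pos hη0
  have hξ1 : ξ ≤ 1 := min_le_left _ _
  set κ := ξ ^ (-(1 / γ)) with hκ
  have hκ1 : 1 ≤ κ := Real.one_le_rpow_of_pos_of_le_one_of_nonpos hξ0 hξ1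
    (neg_nonpos.2 (by positivity))
  have hκγ : κ ^ γ = ξ⁻¹ := by
    rw [hκ, ← Real.rpow_mul hξ0.le, neg_mul, one_div_mul_cancel hgap.ne', Real.rpow_neg_one]
  have hNγ : (N : ℝ) ^ (-γ) ≤ ξ := by
    have hN1 : (1 : ℝ) ≤ N := by exact_mod_cast (by omega : 1 ≤ N)
    refine le_min (Real.rpow_le_one_of_one_le_of_nonpos hN1 (by linarith)) ?_
    rw [hη, hγ, neg_sub, sub_eq_add_neg, Real.rpow_add hN0, ← neg_div]
    gcongr ?_ * ?_
    refine Real.rpow_le_rpow_of_nonpos hn0 ?_ (by norm_num)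
    exact_mod_cast (by omega : n ≤ N)
  have hκN : κ ≤ N := by
    refine (Real.rpow_le_rpow_iff (by positivity) hN0.le hgap).1 ?_
    rw [hκγ, inv_le_comm₀ hξ0 (by positivity), ← Real.rpow_neg hN0.le]
    exact hNγ
  set k := ⌊κ⌋₊ with hk
  have hk1 : 1 ≤ k := (Nat.one_le_floor_iff κ).2 hκ1
  have hkκ : (k : ℝ) ≤ κ := Nat.floor_le (by positivity)
  have hκk : κ ≤ 2 * k := by
    have h1 := Nat.lt_floor_add_one κ
    have h2 : (1 : ℝ) ≤ k := by exact_mod_cast hk1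
    rw [← hk] at h1
    linarith
  have hkN : k ≤ N := by exact_mod_cast hkκ.trans hκN
  have hk0 : (0 : ℝ) < k := by exact_mod_cast hk1
  have hηξ : (N : ℝ) ^ (-(1 / q)) * √n ≤ 2 * (k : ℝ) ^ γ := by
    have h1 : (N : ℝ) ^ (-(1 / q)) * √n = η⁻¹ := by
      rw [hη, hsqrt, mul_inv, inv_inv, Real.rpow_neg hN0.le]
    calc _ = η⁻¹ := h1
      _ ≤ ξ⁻¹ := inv_anti₀ hξ0 (min_le_right _ _)
      _ = κ ^ γ := hκγ.symm
      _ ≤ (2 * k) ^ γ := by gcongr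
      _ = 2 ^ γ * (k : ℝ) ^ γ := Real.mul_rpow two_pos.le hk0.le
      _ ≤ 2 * (k : ℝ) ^ γ := by
        gcongr
        calc (2 : ℝ) ^ γ ≤ 2 ^ (1 : ℝ) := by
              refine Real.rpow_le_rpow_of_exponent_le one_le_two ?_
              have : 0 < 1 / q := by positivity
              linarith
          _ = 2 := Real.rpow_one 2
  have hkpow : √(k : ℝ) * (k : ℝ) ^ γ = (k : ℝ) ^ (1 - 1 / q) := by
    rw [Real.sqrt_eq_rpow, ← Real.rpow_add hk0]
    congr 1
    rw [hγ]
    ring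
  have hθ : ξ ^ ((1 / a - 1 / q) / γ) ≤ (k : ℝ) ^ (1 / q - 1 / a) := by
    have h1 : ξ ^ ((1 / a - 1 / q) / γ) = κ ^ (1 / q - 1 / a) := by
      rw [hκ, ← Real.rpow_mul hξ0.le]
      congr 1
      ring
    rw [h1]
    exact Real.rpow_le_rpow_of_nonpos hk0 hkκ (by linarith)
  refine le_kolmogorovLp hp1 hp2 ha0 h12.le hn fun L hL => ?_
  obtain ⟨x, hxa, hxL⟩ := exists_flat_vector_far hp2 (by linarith) hnN hk1 hkN L hL.le
  set c : ℝ := (k : ℝ) ^ (-(1 / a)) with hc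
  have hc0 : 0 < c := by positivity
  refine ⟨(c : ℂ) • x, ?_, fun y hy => ?_⟩
  · rw [lpNorm_le_iff hp1 ha0 _ zero_le_one, Real.one_rpow, ← ha]
    have h1 : ∀ i, ‖((c : ℂ) • x) i‖ ^ a = c ^ a * ‖x i‖ ^ a := by
      intro i
      rw [Pi.smul_apply, norm_smul, Complex.norm_real, Real.norm_of_nonneg hc0.le,
        Real.mul_rpow hc0.le (norm_nonneg _)]
    simp only [h1]
    rw [← Finset.mul_sum, hxa a ha0, hc, ← Real.rpow_mul hk0.le, neg_mul,
      one_div_mul_cancel ha0.ne', Real.rpow_neg_one, inv_mul_cancel₀ hk0.ne']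
  · have hcc : (c : ℂ) ≠ 0 := by exact_mod_cast hc0.ne'
    have hfar := hxL ((c : ℂ)⁻¹ • y) (L.smul_mem _ hy)
    have hscale : lpNorm p2 ((c : ℂ) • x - y) = c * lpNorm p2 (x - (c : ℂ)⁻¹ • y) := by
      rw [show (c : ℂ) • x - y = (c : ℂ) • (x - (c : ℂ)⁻¹ • y) by
        rw [smul_sub, smul_inv_smul₀ hcc]]
      have : Fact (1 ≤ p2) := ⟨by
        rw [← ENNReal.toReal_le_toReal ENNReal.one_ne_top hp2, ENNReal.toReal_one]
        linarith⟩
      rw [lpNorm_eq_norm_toLp hp2 hq0, lpNorm_eq_norm_toLp hp2 hq0, WithLp.toLp_smul, norm_smul,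
        Complex.norm_real, Real.norm_of_nonneg hc0.le]
    rw [hscale]
    set δ := lpNorm p2 (x - (c : ℂ)⁻¹ • y) with hδ
    have hδ0 : 0 ≤ δ := lpNorm_nonneg hp2 _
    have hδk : (k : ℝ) ^ (1 / q) / 6 ≤ δ := by
      have h1 : (N : ℝ) ^ (-(1 / q)) * (√k * √n) ≤ 2 * (k : ℝ) ^ (1 - 1 / q) := by
        calc _ = √k * ((N : ℝ) ^ (-(1 / q)) * √n) := by ring
          _ ≤ √k * (2 * (k : ℝ) ^ γ) := by gcongr
          _ = _ := by rw [← hkpow]; ring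
      have h2 : (k : ℝ) / 2 ≤ δ * (3 * (k : ℝ) ^ (1 - 1 / q)) :=
        hfar.trans (mul_le_mul_of_nonneg_left (by rw [← hq]; linarith) hδ0)
      have h3 : (k : ℝ) = (k : ℝ) ^ (1 / q) * (k : ℝ) ^ (1 - 1 / q) := by
        rw [← Real.rpow_add hk0, add_sub_cancel, Real.rpow_one]
      have h4 : 0 < (k : ℝ) ^ (1 - 1 / q) := by positivity
      refine le_of_mul_le_mul_right ?_ h4
      nlinarith
    calc _ ≤ (k : ℝ) ^ (1 / q - 1 / a) / 6 := by gcongr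
      _ = c * ((k : ℝ) ^ (1 / q) / 6) := by
        rw [hc, sub_eq_add_neg, Real.rpow_add hk0]
        ring
      _ ≤ _ := by gcongr

theorem le_kolmogorovLp_of_le_two_mul {p1 p2 : ℝ≥0∞} (hp1 : p1 ≠ ∞) (hp2 : p2 ≠ ∞)
    (h2 : 2 ≤ p1.toReal) (h12 : p1.toReal < p2.toReal) {N n : ℕ} (hn : 1 ≤ n) (hnN : n ≤ N)
    (hNn : N ≤ 2 * n) :
    min 1 ((N : ℝ) ^ (1 / p2.toReal) * (n : ℝ) ^ (-(1 : ℝ) / 2)) ^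
      ((1 / p1.toReal - 1 / p2.toReal) / (1 / 2 - 1 / p2.toReal)) / 6 ≤
        kolmogorovLp p1 p2 N n := by
  have hp21 : 1 ≤ p2 := by
    rw [← ENNReal.toReal_le_toReal ENNReal.one_ne_top hp2, ENNReal.toReal_one]
    linarith
  set a := p1.toReal with ha
  set q := p2.toReal with hq
  have : Fact (1 ≤ p2) := ⟨hp21⟩
  have ha0 : 0 < a := by linarith
  have hq0 : 0 < q := by linarith
  have hn0 : (0 : ℝ) < n := by exact_mod_cast hn
  have hN0 : (0 : ℝ) < N := by exact_mod_cast (by omega : 0 < N)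
  have hgap : 0 < 1 / 2 - 1 / q := by
    rw [sub_pos]
    exact one_div_lt_one_div_of_lt two_pos (by linarith)
  have haq : 0 < 1 / a - 1 / q := by
    rw [sub_pos]
    exact one_div_lt_one_div_of_lt ha0 h12
  have hθ0 : 0 ≤ (1 / a - 1 / q) / (1 / 2 - 1 / q) := by positivity
  have hθ1 : (1 / a - 1 / q) / (1 / 2 - 1 / q) ≤ 1 := by
    rw [div_le_one hgap]
    have := one_div_le_one_div_of_le two_pos h2
    linarith
  set θ := (1 / a - 1 / q) / (1 / 2 - 1 / q) with hθ
  have hξ : min 1 ((N : ℝ) ^ (1 / q) * (n : ℝ) ^ (-(1 : ℝ) / 2)) ^ θ ≤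
      2 * (N : ℝ) ^ (1 / q - 1 / a) := by
    have h1 : (n : ℝ) ^ (-(1 : ℝ) / 2) ≤ 2 * (N : ℝ) ^ (-(1 : ℝ) / 2) := by
      calc (n : ℝ) ^ (-(1 : ℝ) / 2) ≤ ((N : ℝ) / 4) ^ (-(1 : ℝ) / 2) := by
            refine Real.rpow_le_rpow_of_nonpos (by positivity) ?_ (by norm_num)
            have : (N : ℝ) ≤ 2 * n := by exact_mod_cast hNn
            linarith
        _ = 2 * (N : ℝ) ^ (-(1 : ℝ) / 2) := by
            rw [Real.div_rpow hN0.le (by norm_num), show (4 : ℝ) = 2 ^ (2 : ℝ) by norm_num,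
              ← Real.rpow_mul (by norm_num)]
            norm_num
            ring
    calc _ ≤ (2 * (N : ℝ) ^ (-(1 / 2 - 1 / q))) ^ θ := by
          refine Real.rpow_le_rpow (by positivity) ((min_le_right _ _).trans ?_) hθ0
          calc _ ≤ (N : ℝ) ^ (1 / q) * (2 * (N : ℝ) ^ (-(1 : ℝ) / 2)) := by gcongr
            _ = _ := by
              rw [neg_sub, sub_eq_add_neg, Real.rpow_add hN0, ← neg_div]
              ring
      _ = 2 ^ θ * (N : ℝ) ^ (1 / q - 1 / a) := by
          rw [Real.mul_rpow two_pos.le (by positivity), ← Real.rpow_mul hN0.le]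
          congr 2
          rw [hθ, neg_mul, mul_div_cancel₀ _ hgap.ne', neg_sub]
      _ ≤ 2 * (N : ℝ) ^ (1 / q - 1 / a) := by
          gcongr
          calc (2 : ℝ) ^ θ ≤ 2 ^ (1 : ℝ) := Real.rpow_le_rpow_of_exponent_le one_le_two hθ1
            _ = 2 := Real.rpow_one 2
  refine le_kolmogorovLp hp1 hp2 ha0 h12.le hn fun L hL => ?_
  set Λ : Submodule ℂ (PiLp p2 fun _ : Fin N => ℂ) :=
    L.comap (WithLp.linearEquiv p2 ℂ (Fin N → ℂ)).toLinearMap with hΛ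
  have hproper : ∃ x, x ∉ Λ := by
    by_contra! h
    have htop : L = ⊤ := by
      rw [eq_top_iff]
      exact fun x _ => h (WithLp.toLp p2 x)
    rw [htop, finrank_top, Module.finrank_fin_fun] at hL
    omega
  obtain ⟨x₀, hx₀, hx₀L⟩ := riesz_lemma Λ.closed_of_finiteDimensional hproper
    (by norm_num : (1 / 2 : ℝ) < 1)
  have hx0 : 0 < ‖x₀‖ := norm_pos_iff.2 fun h => hx₀ (h ▸ Λ.zero_mem)
  set c : ℝ := (N : ℝ) ^ (1 / q - 1 / a) / ‖x₀‖ with hc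
  have hc0 : 0 < c := by positivity
  have hcc : (c : ℂ) ≠ 0 := by exact_mod_cast hc0.ne'
  refine ⟨(c : ℂ) • WithLp.ofLp x₀, ?_, fun y hy => ?_⟩
  · have hmean := rpow_sum_le_card_rpow_mul Finset.univ (fun i => ‖((c : ℂ) • WithLp.ofLp x₀) i‖)
      (fun i => norm_nonneg _) ha0 h12.le
    have h3 : (∑ i, ‖((c : ℂ) • WithLp.ofLp x₀) i‖ ^ q) ^ (1 / q) = c * ‖x₀‖ := by
      have h4 := lpNorm_eq_norm_toLp hp2 hq0 ((c : ℂ) • WithLp.ofLp x₀)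
      rw [lpNorm, if_neg hp2, WithLp.toLp_smul, norm_smul, Complex.norm_real,
        Real.norm_of_nonneg hc0.le] at h4
      exact h4
    rw [h3, Finset.card_univ, Fintype.card_fin] at hmean
    rw [lpNorm, if_neg hp1]
    refine hmean.trans (le_of_eq ?_)
    rw [hc, div_mul_cancel₀ _ hx0.ne', ← Real.rpow_add hN0]
    simp
  · have h1 := hx₀L (WithLp.toLp p2 ((c : ℂ)⁻¹ • y)) (L.smul_mem _ hy)
    have h3 : lpNorm p2 ((c : ℂ) • WithLp.ofLp x₀ - y) =
        c * ‖x₀ - WithLp.toLp p2 ((c : ℂ)⁻¹ • y)‖ := by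
      rw [lpNorm_eq_norm_toLp hp2 hq0, show (c : ℂ) • WithLp.ofLp x₀ - y =
        (c : ℂ) • (WithLp.ofLp x₀ - (c : ℂ)⁻¹ • y) by rw [smul_sub, smul_inv_smul₀ hcc],
        WithLp.toLp_smul, norm_smul, Complex.norm_real, Real.norm_of_nonneg hc0.le]
      rfl
    rw [h3]
    calc _ ≤ (2 * (N : ℝ) ^ (1 / q - 1 / a)) / 6 := by gcongr
      _ ≤ (N : ℝ) ^ (1 / q - 1 / a) / 2 := by
        have : 0 < (N : ℝ) ^ (1 / q - 1 / a) := by positivity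
        linarith
      _ = c * (1 / 2 * ‖x₀‖) := by rw [hc]; field_simp
      _ ≤ _ := by gcongr

end Lower

/-- Let `2 ≤ p1 < p2 < ∞` and `θ = (1/p1 - 1/p2)/(1/2 - 1/p2)`. There is a
constant `c > 0`, depending only on `p1, p2`, such that for all `N` and all `n ≤ N`,
`c⁻¹ ξ^θ ≤ d_n(id : ℓ_{p1}^N → ℓ_{p2}^N) ≤ c ξ^θ`, where `ξ = min{1, N^{1/p2} n^{-1/2}}`. -/
theorem kolmogorov_id_lp_large (p1 p2 : ℝ≥0∞) (hp1 : 2 ≤ p1) (hp12 : p1 < p2)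
    (hp2 : p2 ≠ ∞) :
    ∃ c : ℝ, 0 < c ∧ ∀ N n : ℕ, 1 ≤ n → n ≤ N →
      c⁻¹ * min 1 ((N : ℝ) ^ (1 / p2.toReal) * (n : ℝ) ^ (-(1 : ℝ) / 2)) ^
          ((1 / p1.toReal - 1 / p2.toReal) / (1 / 2 - 1 / p2.toReal)) ≤
        kolmogorovLp p1 p2 N n ∧
      kolmogorovLp p1 p2 N n ≤
        c * min 1 ((N : ℝ) ^ (1 / p2.toReal) * (n : ℝ) ^ (-(1 : ℝ) / 2)) ^
          ((1 / p1.toReal - 1 / p2.toReal) / (1 / 2 - 1 / p2.toReal)) := by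
  have hp1t : p1 ≠ ∞ := (hp12.trans_le le_top).ne
  have h2 : 2 ≤ p1.toReal := by
    rw [← ENNReal.toReal_ofNat 2]
    exact (ENNReal.toReal_le_toReal ENNReal.ofNat_ne_top hp1t).2 hp1
  have h12 : p1.toReal < p2.toReal := (ENNReal.toReal_lt_toReal hp1t hp2).2 hp12
  have hp21 : 1 ≤ p2 := one_le_two.trans (hp1.trans hp12.le)
  obtain ⟨c, hc, hupper⟩ := exists_kolmogorovLp_le hp1t hp2 h2 h12 hp21
  refine ⟨max c 6, lt_max_of_lt_left hc, fun N n hn hnN => ⟨?_, ?_⟩⟩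
  · have hlower : min 1 ((N : ℝ) ^ (1 / p2.toReal) * (n : ℝ) ^ (-(1 : ℝ) / 2)) ^
        ((1 / p1.toReal - 1 / p2.toReal) / (1 / 2 - 1 / p2.toReal)) / 6 ≤
          kolmogorovLp p1 p2 N n := by
      rcases le_total (2 * n) N with h | h
      · exact le_kolmogorovLp_of_two_mul_le hp1t hp2 h2 h12 hn h
      · exact le_kolmogorovLp_of_le_two_mul hp1t hp2 h2 h12 hn hnN h
    refine le_trans ?_ ((div_eq_inv_mul _ _).ge.trans hlower)
    exact mul_le_mul_of_nonneg_right (inv_anti₀ (by norm_num) (le_max_right _ _)) (by positivity)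
  · refine (hupper N n hn hnN).trans ?_
    exact mul_le_mul_of_nonneg_right (le_max_left _ _) (by positivity)
end
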